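/- arXiv:0911.3971 — 2 statements merged into one kernel-verified Lean document; each statement's English description precedes it below -/
import Mathlib

section
/- Let M ≥ 1 and let Ω ⊆ [0, π/2] satisfy the order-M lacunary covering property. Then there exists a constant C > 0 such that for every N ≥ 2 and for every probability measure μ on the parameter space T = {(φ, p, w, h) ∈ [0, π/2] × [0,1]² × (0,1]² : φ ∈ Ω ∪ {0} and R(φ,p,w,h) ⊆ [0,1]²}, where R(φ,p,w,h) denotes the rectangle obtained by rotating [0,w] × [0,h] by angle φ and translating by p, there is a set P of N points in [0,1]² with (∫_T |#(P ∩ R(t)) − N·area(R(t))|² dμ(t))^{1/2} ≤ C (log N)^{2M + 1/2}. -/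
open MeasureTheory

noncomputable section

/-- Rotation of the plane by angle `φ`. -/
def rot (φ : ℝ) (x : ℝ × ℝ) : ℝ × ℝ :=
  (x.1 * Real.cos φ - x.2 * Real.sin φ, x.1 * Real.sin φ + x.2 * Real.cos φ)

/-- The rectangle obtained by rotating `[0,w] × [0,h]` by angle `φ` and translating by `p`. -/
def rect (φ : ℝ) (p : ℝ × ℝ) (w h : ℝ) : Set (ℝ × ℝ) :=
  (fun x => p + rot φ x) '' (Set.Icc 0 w ×ˢ Set.Icc 0 h)

/-- The unit square `[0,1]²`. -/
def unitSq : Set (ℝ × ℝ) := Set.Icc (0:ℝ) 1 ×ˢ Set.Icc (0:ℝ) 1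

/-- `plog n = max {1, log₂ n}`. -/
def plog (n : ℕ) : ℝ := max 1 (Real.logb 2 n)

/-- `Ω` satisfies the order-`M` lacunary covering property: there is a constant `K` such
that for every `0 < δ < 1/2` the set `Ω` can be covered by at most `K (log₂(1/δ))^M`
intervals of length `δ`. -/
def LacunaryCovering (Ω : Set ℝ) (M : ℕ) : Prop :=
  ∃ K : ℝ, ∀ δ : ℝ, 0 < δ → δ < 1 / 2 →
    ∃ s : Finset ℝ, (s.card : ℝ) ≤ K * (Real.logb 2 (1 / δ)) ^ M ∧
      Ω ⊆ ⋃ x ∈ s, Set.Icc x (x + δ)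

/-- The parameter space `T` of rectangles: tuples `(φ, p, w, h)` with
`φ ∈ (Ω ∪ {0}) ∩ [0, π/2]`, `p ∈ [0,1]²`, `w, h ∈ (0,1]`, and the corresponding
rectangle contained in `[0,1]²`. -/
def paramSet (Ω : Set ℝ) : Set (ℝ × (ℝ × ℝ) × ℝ × ℝ) :=
  {t | t.1 ∈ Set.Icc 0 (Real.pi / 2) ∧ (t.1 ∈ Ω ∨ t.1 = 0) ∧
       t.2.1 ∈ unitSq ∧ t.2.2.1 ∈ Set.Ioc (0:ℝ) 1 ∧ t.2.2.2 ∈ Set.Ioc (0:ℝ) 1 ∧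
       rect t.1 t.2.1 t.2.2.1 t.2.2.2 ⊆ unitSq}

section Rounding

variable {ι E F : Type*} [Fintype ι]
  [NormedAddCommGroup E] [InnerProductSpace ℝ E]
  [NormedAddCommGroup F] [InnerProductSpace ℝ F]

/-- The trace of `A* A` compressed to the subspace `W` is at most `τ`. -/
def TraceBound (A : E →ₗ[ℝ] F) (W : Submodule ℝ E) (τ : ℝ) : Prop :=
  ∀ (n : ℕ) (e : Fin n → E), Orthonormal ℝ e → (∀ i, e i ∈ W) → ∑ i, ‖A (e i)‖ ^ 2 ≤ τ

theorem TraceBound.nonneg {A : E →ₗ[ℝ] F} {W : Submodule ℝ E} {τ : ℝ}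
    (h : TraceBound A W τ) : 0 ≤ τ := by
  have := h 0 Fin.elim0 ⟨fun i => i.elim0, fun i => i.elim0⟩ (fun i => i.elim0)
  simpa using this

theorem TraceBound.mono {A : E →ₗ[ℝ] F} {W W' : Submodule ℝ E} {τ : ℝ}
    (h : TraceBound A W τ) (hW : W' ≤ W) : TraceBound A W' τ :=
  fun n e he hm => h n e he fun i => hW (hm i)

/-- Removing from `W` a direction `d` orthogonal to `W'` lowers the trace bound by the
Rayleigh quotient of `d`. -/
theorem TraceBound.exists_sub {A : E →ₗ[ℝ] F} {W W' : Submodule ℝ E} {τ : ℝ}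
    (h : TraceBound A W τ) (hW : W' ≤ W) {d : E} (hd : d ∈ W)
    (hperp : ∀ y ∈ W', inner ℝ d y = 0) :
    ∃ q : ℝ, 0 ≤ q ∧ ‖A d‖ ^ 2 = q * ‖d‖ ^ 2 ∧ TraceBound A W' (τ - q) := by
  by_cases hd0 : d = 0
  · exact ⟨0, le_rfl, by simp [hd0], by simpa using h.mono hW⟩
  have hn : ‖d‖ ≠ 0 := by simpa using hd0
  refine ⟨‖A d‖ ^ 2 / ‖d‖ ^ 2, by positivity, by field_simp, fun n e he hm => ?_⟩
  have key := h (n + 1) (Fin.cons (‖d‖⁻¹ • d) e) ?_ ?_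
  · rw [Fin.sum_univ_succ] at key
    simp only [Fin.cons_zero, Fin.cons_succ, map_smul, norm_smul, norm_inv, norm_norm] at key
    have : (‖d‖⁻¹ * ‖A d‖) ^ 2 = ‖A d‖ ^ 2 / ‖d‖ ^ 2 := by field_simp
    linarith
  · constructor
    · intro i
      refine Fin.cases ?_ (fun j => ?_) i
      · simp [norm_smul, hn]
      · simpa using he.1 j
    · intro i j
      refine Fin.cases ?_ (fun i => ?_) i <;> refine Fin.cases ?_ (fun j => ?_) j
      · simp
      · intro _
        simp [inner_smul_left, hperp _ (hm j)]
      · intro _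
        rw [real_inner_comm]
        simp [inner_smul_left, hperp _ (hm i)]
      · intro hij
        have : i ≠ j := fun h => hij (by rw [h])
        simpa using he.2 this
  · intro i
    refine Fin.cases ?_ (fun j => ?_) i
    · simpa using W.smul_mem _ hd
    · simpa using hW (hm j)

/-- The coordinates of a fractional colouring that are not yet integral. -/
def alive (x : ι → ℝ) : Finset ι := by
  classical exact Finset.univ.filter fun i => x i ≠ 0 ∧ x i ≠ 1

theorem mem_alive {x : ι → ℝ} {i : ι} : i ∈ alive x ↔ x i ≠ 0 ∧ x i ≠ 1 := by
  simp [alive]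

/-- Moving from a point of the cube in a direction supported on its fractional coordinates,
one reaches a point with fewer fractional coordinates. -/
theorem exists_step (x u : ι → ℝ) (hx : ∀ i, x i ∈ Set.Icc (0 : ℝ) 1)
    (hu : ∀ i, u i ≠ 0 → i ∈ alive x) (hne : ∃ p, u p ≠ 0) :
    ∃ s : ℝ, 0 ≤ s ∧ (∀ i, x i + s * u i ∈ Set.Icc (0 : ℝ) 1) ∧
      alive (fun i => x i + s * u i) ⊂ alive x := by
  classical
  let g : ι → ℝ := fun i => if 0 < u i then (1 - x i) / u i else x i / (-u i)
  obtain ⟨p, hp⟩ := hne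
  obtain ⟨i, hi, hmin⟩ := Finset.exists_min_image (Finset.univ.filter fun i => u i ≠ 0) g
    ⟨p, by simpa using hp⟩
  have hi' : u i ≠ 0 := by simpa using hi
  have hg0 : 0 ≤ g i := by
    have := hx i
    simp only [g]
    split_ifs with h
    · exact div_nonneg (by linarith [this.2]) h.le
    · exact div_nonneg this.1 (by linarith)
  refine ⟨g i, hg0, fun j => ?_, ?_⟩
  · by_cases hj : u j = 0
    · simpa [hj] using hx j
    have hle := hmin j (by simpa using hj)
    have hxj := hx j
    rcases lt_or_gt_of_ne hj with h | h
    · have : g j = x j / (-u j) := by simp [g, h.le]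
      rw [this, le_div_iff₀ (by linarith)] at hle
      constructor <;> nlinarith [hxj.1, hxj.2]
    · have : g j = (1 - x j) / u j := by simp [g, h]
      rw [this, le_div_iff₀ h] at hle
      constructor <;> nlinarith [hxj.1, hxj.2]
  · rw [Finset.ssubset_iff_of_subset]
    · refine ⟨i, hu i hi', ?_⟩
      rw [mem_alive, not_and_or, not_not, not_not]
      rcases lt_or_gt_of_ne hi' with h | h
      · left
        have : g i = x i / (-u i) := by simp [g, h.le]
        rw [this]; field_simp; ring
      · right
        have : g i = (1 - x i) / u i := by simp [g, h]
        rw [this]; field_simp; ring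
    · intro j hj
      by_cases h : u j = 0
      · simpa [mem_alive, h] using hj
      · exact hu j h

/-- `‖A ·‖² ≤ (G + q) ‖·‖²` on a sum of two orthogonal vectors with Rayleigh quotients at most
`G` and `q`. -/
theorem norm_map_add_sq_le {α β a b G q : ℝ} (hG : 0 ≤ G) (hq : 0 ≤ q) (ha : α ^ 2 ≤ G * a) (hb : β ^ 2 ≤ q * b) (ha0 : 0 ≤ a)
    (hb0 : 0 ≤ b) : (α + β) ^ 2 ≤ (G + q) * (a + b) := by
  have h1 : (2 * (α * β)) ^ 2 ≤ (G * b + q * a) ^ 2 := by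
    have : α ^ 2 * β ^ 2 ≤ (G * a) * (q * b) :=
      mul_le_mul ha hb (sq_nonneg _) (mul_nonneg hG ha0)
    nlinarith [sq_nonneg (G * b - q * a)]
  have h2 : 2 * (α * β) ≤ G * b + q * a :=
    le_of_sq_le_sq h1 (by positivity)
  nlinarith

/-- One phase of the Gram–Schmidt walk with pivot `p`, in deterministic form. -/
theorem exists_rounding_aux [FiniteDimensional ℝ E] (A : E →ₗ[ℝ] F) (v : ι → E) {κ : ℝ}
    (hκ : 0 ≤ κ) (hv : ∀ i, ‖v i‖ ^ 2 ≤ κ) (k : ℕ) :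
    ∀ (x : ι → ℝ), (∀ i, x i ∈ Set.Icc (0 : ℝ) 1) → (alive x).card = k → ∀ z : F,
      (∀ (p : ι), p ∈ alive x → ∀ (τ G : ℝ) (w : E), 0 ≤ G →
        TraceBound A (Submodule.span ℝ (v '' {i | i ∈ alive x ∧ i ≠ p})) τ →
        v p - w ∈ Submodule.span ℝ (v '' {i | i ∈ alive x ∧ i ≠ p}) →
        (∀ y ∈ Submodule.span ℝ (v '' {i | i ∈ alive x ∧ i ≠ p}), inner ℝ w y = 0) →
        ‖A w‖ ^ 2 ≤ G * ‖w‖ ^ 2 →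
        ∃ χ : ι → ℝ, (∀ i, χ i = 0 ∨ χ i = 1) ∧
          ‖z + A (∑ i, (χ i - x i) • v i)‖ ^ 2 ≤ ‖z‖ ^ 2 + κ * (τ + x p * (1 - x p) * G)) ∧
      (∀ τ : ℝ, TraceBound A (Submodule.span ℝ (v '' {i | i ∈ alive x})) τ →
        ∃ χ : ι → ℝ, (∀ i, χ i = 0 ∨ χ i = 1) ∧
          ‖z + A (∑ i, (χ i - x i) • v i)‖ ^ 2 ≤ ‖z‖ ^ 2 + κ * τ) := by
  classical
  induction k using Nat.strong_induction_on with
  | _ k ih =>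
  intro x hx hk z
  have pivot : (∀ (p : ι), p ∈ alive x → ∀ (τ G : ℝ) (w : E), 0 ≤ G →
        TraceBound A (Submodule.span ℝ (v '' {i | i ∈ alive x ∧ i ≠ p})) τ →
        v p - w ∈ Submodule.span ℝ (v '' {i | i ∈ alive x ∧ i ≠ p}) →
        (∀ y ∈ Submodule.span ℝ (v '' {i | i ∈ alive x ∧ i ≠ p}), inner ℝ w y = 0) →
        ‖A w‖ ^ 2 ≤ G * ‖w‖ ^ 2 →
        ∃ χ : ι → ℝ, (∀ i, χ i = 0 ∨ χ i = 1) ∧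
          ‖z + A (∑ i, (χ i - x i) • v i)‖ ^ 2 ≤
            ‖z‖ ^ 2 + κ * (τ + x p * (1 - x p) * G)) := by
    intro p hp τ G w hG hτ hw hperp hAw
    set W := Submodule.span ℝ (v '' {i | i ∈ alive x ∧ i ≠ p}) with hWdef
    -- a direction supported on the alive coordinates with `∑ u i • v i = w`
    obtain ⟨u, hu, hup, huw⟩ : ∃ u : ι → ℝ, (∀ i, u i ≠ 0 → i ∈ alive x) ∧ u p = 1 ∧
        ∑ i, u i • v i = w := by
      have hset : {i | i ∈ alive x ∧ i ≠ p} = (((alive x).erase p : Finset ι) : Set ι) := by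
        ext i; simp [and_comm]
      rw [hWdef, hset, Submodule.mem_span_image_finset_iff_exists_fun'] at hw
      obtain ⟨c, hc⟩ := hw
      refine ⟨fun i => if i = p then 1 else if i ∈ alive x then -c i else 0, ?_, by simp, ?_⟩
      · intro i hi
        by_cases h : i = p
        · rwa [h]
        · by_contra h'
          simp [h, h'] at hi
      · have : ∀ i, (if i = p then (1 : ℝ) else if i ∈ alive x then -c i else 0) • v i
            = (if i = p then v i else 0) - (if i ∈ (alive x).erase p then c i • v i else 0) := by
          intro i
          by_cases h : i = p
          · simp [h]
          · by_cases h' : i ∈ alive x <;> simp [h, h']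
        simp_rw [this, Finset.sum_sub_distrib]
        rw [Finset.sum_ite_mem, Finset.univ_inter, hc]
        simp
    have hwn : ‖w‖ ^ 2 ≤ κ := by
      have h0 := hperp _ hw
      have : ‖v p‖ ^ 2 = ‖w‖ ^ 2 + ‖v p - w‖ ^ 2 := by
        have := norm_add_sq_real w (v p - w)
        rw [h0] at this
        simpa using this
      nlinarith [hv p, sq_nonneg ‖v p - w‖]
    have hAκ : ‖A w‖ ^ 2 ≤ κ * G := by nlinarith
    -- the step
    obtain ⟨s, hs, hx', hss⟩ : ∃ s : ℝ,
        s * (2 * inner ℝ z (A w) + κ * G * (1 - 2 * x p)) ≤ 0 ∧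
        (∀ i, x i + s * u i ∈ Set.Icc (0 : ℝ) 1) ∧
        alive (fun i => x i + s * u i) ⊂ alive x := by
      rcases le_total (2 * inner ℝ z (A w) + κ * G * (1 - 2 * x p)) 0 with h | h
      · obtain ⟨s, hs, h1, h2⟩ := exists_step x u hx hu ⟨p, by simp [hup]⟩
        exact ⟨s, mul_nonpos_of_nonneg_of_nonpos hs h, h1, h2⟩
      · obtain ⟨s, hs, h1, h2⟩ := exists_step x (fun i => - u i) hx
          (fun i hi => hu i (by simpa using hi)) ⟨p, by simp [hup]⟩
        refine ⟨-s, mul_nonpos_of_nonpos_of_nonneg (by linarith) h, fun i => ?_, ?_⟩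
        · have := h1 i
          rwa [mul_neg, ← neg_mul] at this
        · simpa using h2
    set x' : ι → ℝ := fun i => x i + s * u i with hx'def
    have hx'p : x' p = x p + s := by simp [hx'def, hup]
    have hcard : (alive x').card < k := hk ▸ Finset.card_lt_card hss
    obtain ⟨ih1, ih2⟩ := ih _ hcard x' hx' rfl (z + s • A w)
    have hsplit : ∀ χ : ι → ℝ, z + s • A w + A (∑ i, (χ i - x' i) • v i) =
        z + A (∑ i, (χ i - x i) • v i) := by
      intro χ
      rw [add_assoc, ← map_smul, ← map_add, ← huw, Finset.smul_sum, ← Finset.sum_add_distrib]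
      congr 3
      ext i
      rw [smul_smul, ← add_smul]
      congr 1
      simp only [hx'def]; ring
    have hnorm : ‖z + s • A w‖ ^ 2 + κ * (x' p * (1 - x' p) * G) ≤
        ‖z‖ ^ 2 + κ * (x p * (1 - x p) * G) := by
      rw [norm_add_sq_real, inner_smul_right, norm_smul, mul_pow, hx'p, Real.norm_eq_abs, sq_abs]
      nlinarith [mul_nonneg (sq_nonneg s) (sub_nonneg.2 hAκ)]
    by_cases hpx : p ∈ alive x'
    · set W' := Submodule.span ℝ (v '' {i | i ∈ alive x' ∧ i ≠ p}) with hW'def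
      have hWW : W' ≤ W := Submodule.span_mono (Set.image_mono fun i hi => ⟨hss.1 hi.1, hi.2⟩)
      have hmem : W'.starProjection (v p) ∈ W' := Submodule.starProjection_apply_mem _ _
      have hdW : v p - W'.starProjection (v p) - w ∈ W := by
        have := W.sub_mem hw (hWW hmem)
        convert this using 1; abel
      have hw'perp : ∀ y ∈ W', inner ℝ (v p - W'.starProjection (v p)) y = 0 := by
        intro y hy
        have := W'.sub_starProjection_mem_orthogonal (v p)
        exact (Submodule.mem_orthogonal' _ _).1 this y hy
      obtain ⟨q, hq, hqd, hτ'⟩ := hτ.exists_sub hWW hdW (fun y hy => by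
        rw [inner_sub_left, hw'perp y hy, hperp y (hWW hy), sub_zero])
      have hw'eq : v p - W'.starProjection (v p) = w + (v p - W'.starProjection (v p) - w) := by
        abel
      obtain ⟨χ, hχ, hle⟩ := ih1 p hpx (τ - q) (G + q) (v p - W'.starProjection (v p))
        (by positivity) hτ' (by rwa [sub_sub_cancel]) hw'perp (by
          have hort := hperp _ hdW
          have hn := norm_add_sq_real w (v p - W'.starProjection (v p) - w)
          rw [hort, ← hw'eq] at hn
          rw [hn, mul_zero, add_zero]
          refine le_trans ?_ (norm_map_add_sq_le hG hq hAw hqd.le (sq_nonneg _) (sq_nonneg _))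
          have := norm_add_le (A w) (A (v p - W'.starProjection (v p) - w))
          rw [← map_add, ← hw'eq] at this
          gcongr)
      refine ⟨χ, hχ, ?_⟩
      rw [← hsplit]
      refine hle.trans ?_
      have h01 := hx' p
      have : x' p * (1 - x' p) ≤ 1 := by nlinarith [h01.1, h01.2]
      have h2 : κ * (q * (x' p * (1 - x' p) - 1)) ≤ 0 := by
        have : q * (x' p * (1 - x' p) - 1) ≤ 0 := by nlinarith
        nlinarith
      nlinarith
    · obtain ⟨χ, hχ, hle⟩ := ih2 τ (hτ.mono (Submodule.span_mono (Set.image_mono fun i hi =>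
        ⟨hss.1 hi, fun h => hpx (h ▸ hi)⟩)))
      refine ⟨χ, hχ, ?_⟩
      rw [← hsplit]
      refine hle.trans ?_
      have : x' p * (1 - x' p) = 0 := by
        rw [mem_alive, not_and_or, not_not, not_not] at hpx
        rcases hpx with h | h <;> simp [h]
      rw [this] at hnorm
      nlinarith
  refine ⟨pivot, fun τ hτ => ?_⟩
  rcases (alive x).eq_empty_or_nonempty with h | ⟨p, hp⟩
  · refine ⟨x, fun i => ?_, ?_⟩
    · have : i ∉ alive x := by simp [h]
      rw [mem_alive] at this
      tauto
    · have h0 := hτ.nonneg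
      simp only [sub_self, zero_smul, Finset.sum_const_zero, map_zero, add_zero]
      exact le_add_of_nonneg_right (mul_nonneg hκ h0)
  · set W' := Submodule.span ℝ (v '' {i | i ∈ alive x ∧ i ≠ p}) with hW'def
    have hWW : W' ≤ Submodule.span ℝ (v '' {i | i ∈ alive x}) :=
      Submodule.span_mono (Set.image_mono fun i hi => hi.1)
    have hmem : W'.starProjection (v p) ∈ W' := Submodule.starProjection_apply_mem _ _
    have hw'perp : ∀ y ∈ W', inner ℝ (v p - W'.starProjection (v p)) y = 0 := by
      intro y hy
      have := W'.sub_starProjection_mem_orthogonal (v p)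
      exact (Submodule.mem_orthogonal' _ _).1 this y hy
    obtain ⟨q, hq, hqd, hτ'⟩ := hτ.exists_sub hWW (d := v p - W'.starProjection (v p))
      (Submodule.sub_mem _ (Submodule.subset_span ⟨p, hp, rfl⟩) (hWW hmem)) hw'perp
    obtain ⟨χ, hχ, hle⟩ := pivot p hp (τ - q) q _ hq hτ' (by rwa [sub_sub_cancel]) hw'perp hqd.le
    refine ⟨χ, hχ, hle.trans ?_⟩
    have h01 := hx p
    have : x p * (1 - x p) ≤ 1 := by nlinarith [h01.1, h01.2]
    have h2 : κ * (q * (x p * (1 - x p) - 1)) ≤ 0 := by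
      have : q * (x p * (1 - x p) - 1) ≤ 0 := by nlinarith
      nlinarith
    nlinarith

/-- Rounding with bounded quadratic discrepancy: if `‖v i‖² ≤ κ`, every point `x` of the cube can be
rounded to a vertex `χ` such that the weighted sum of the squares of the discrepancies
`⟪U t, ∑ (χ i - x i) • v i⟫` is at most `κ ∑ wt t ‖U t‖²`. -/
theorem exists_rounding [FiniteDimensional ℝ E] {T : Type*} [Fintype T] (wt : T → ℝ)
    (hwt : ∀ t, 0 ≤ wt t) (U : T → E) (v : ι → E) {κ : ℝ} (hκ : 0 ≤ κ)
    (hv : ∀ i, ‖v i‖ ^ 2 ≤ κ) (x : ι → ℝ) (hx : ∀ i, x i ∈ Set.Icc (0 : ℝ) 1) :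
    ∃ χ : ι → ℝ, (∀ i, χ i = 0 ∨ χ i = 1) ∧
      ∑ t, wt t * (∑ i, (χ i - x i) * inner ℝ (U t) (v i)) ^ 2 ≤
        κ * ∑ t, wt t * ‖U t‖ ^ 2 := by
  let A : E →ₗ[ℝ] EuclideanSpace ℝ T :=
    { toFun := fun y => WithLp.toLp 2 fun t => √(wt t) * inner ℝ (U t) y
      map_add' := fun y y' => by ext t; simp [inner_add_right, mul_add]
      map_smul' := fun c y => by ext t; simp [inner_smul_right]; ring }
  have hA : ∀ y, ‖A y‖ ^ 2 = ∑ t, wt t * (inner ℝ (U t) y) ^ 2 := by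
    intro y
    rw [EuclideanSpace.norm_sq_eq]
    refine Finset.sum_congr rfl fun t _ => ?_
    simp only [A, LinearMap.coe_mk, AddHom.coe_mk, Real.norm_eq_abs, sq_abs, mul_pow]
    rw [Real.sq_sqrt (hwt t)]
  have htr : TraceBound A (Submodule.span ℝ (v '' {i | i ∈ alive x}))
      (∑ t, wt t * ‖U t‖ ^ 2) := by
    intro n e he _
    simp_rw [hA]
    rw [Finset.sum_comm]
    refine Finset.sum_le_sum fun t _ => ?_
    rw [← Finset.mul_sum]
    refine mul_le_mul_of_nonneg_left ?_ (hwt t)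
    have := he.sum_inner_products_le (U t) (s := Finset.univ)
    simpa [real_inner_comm] using this
  obtain ⟨χ, hχ, hle⟩ := (exists_rounding_aux A v hκ hv _ x hx rfl 0).2 _ htr
  refine ⟨χ, hχ, ?_⟩
  rw [zero_add, hA, norm_zero] at hle
  simpa [inner_sum, inner_smul_right] using hle

end Rounding

section Dyadic

/-- Coefficients of the dyadic decomposition of the initial segment `[0, b)`. -/
def dyadicCoeff (L b : ℕ) (s : Fin L × Fin (2 ^ L)) : ℝ :=
  if b / 2 ^ (s.1 : ℕ) % 2 = 1 ∧ (s.2 : ℕ) + 1 = b / 2 ^ (s.1 : ℕ) then 1 else 0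

/-- The dyadic intervals containing `m`. -/
def dyadicPoint (L m : ℕ) (s : Fin L × Fin (2 ^ L)) : ℝ :=
  if m / 2 ^ (s.1 : ℕ) = (s.2 : ℕ) then 1 else 0

theorem sum_dyadic_bits (L m b : ℕ) :
    (∑ j ∈ Finset.range L, if b / 2 ^ j % 2 = 1 ∧ m / 2 ^ j + 1 = b / 2 ^ j then (1 : ℝ) else 0)
      = (if m < b then 1 else 0) - (if m / 2 ^ L < b / 2 ^ L then 1 else 0) := by
  induction L with
  | zero => simp
  | succ L ih =>
    rw [Finset.sum_range_succ, ih, pow_succ, ← Nat.div_div_eq_div_mul, ← Nat.div_div_eq_div_mul]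
    generalize m / 2 ^ L = m'
    generalize b / 2 ^ L = b'
    by_cases h1 : m' < b' <;> by_cases h2 : m' / 2 < b' / 2 <;>
      by_cases h3 : b' % 2 = 1 ∧ m' + 1 = b' <;> simp only [h1, h2, h3, if_true, if_false] <;>
      first | omega | norm_num

theorem sum_dyadicCoeff_mul_dyadicPoint {L m b : ℕ} (hm : m < 2 ^ L) (hb : b < 2 ^ L) :
    ∑ s, dyadicCoeff L b s * dyadicPoint L m s = if m < b then 1 else 0 := by
  have h := sum_dyadic_bits L m b
  rw [Nat.div_eq_of_lt hm, Nat.div_eq_of_lt hb] at h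
  simp only [lt_irrefl, if_false, sub_zero] at h
  rw [← h, Fintype.sum_prod_type, ← Fin.sum_univ_eq_sum_range
    (fun j => if b / 2 ^ j % 2 = 1 ∧ m / 2 ^ j + 1 = b / 2 ^ j then (1 : ℝ) else 0)]
  refine Finset.sum_congr rfl fun j _ => ?_
  have hlt : m / 2 ^ (j : ℕ) < 2 ^ L := (Nat.div_le_self _ _).trans_lt hm
  rw [Finset.sum_eq_single ⟨m / 2 ^ (j : ℕ), hlt⟩]
  · simp [dyadicCoeff, dyadicPoint]
  · intro k _ hk
    have : m / 2 ^ (j : ℕ) ≠ k := fun h => hk (Fin.ext h.symm)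
    simp [dyadicPoint, this]
  · simp

theorem sum_sq_dyadicCoeff_le (L b : ℕ) : ∑ s, dyadicCoeff L b s ^ 2 ≤ L := by
  rw [Fintype.sum_prod_type]
  refine (Finset.sum_le_card_nsmul _ _ 1 fun j _ => ?_).trans (by simp)
  simp only [dyadicCoeff, ite_pow, one_pow, ne_eq, OfNat.ofNat_ne_zero, not_false_eq_true,
    zero_pow, Finset.sum_boole]
  rw [Nat.cast_le_one, Finset.card_le_one]
  intro k hk k' hk'
  simp only [Finset.mem_filter, Finset.mem_univ, true_and] at hk hk'
  exact Fin.ext (by omega)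

theorem sum_sq_dyadicPoint_le (L m : ℕ) : ∑ s, dyadicPoint L m s ^ 2 ≤ L := by
  rw [Fintype.sum_prod_type]
  refine (Finset.sum_le_card_nsmul _ _ 1 fun j _ => ?_).trans (by simp)
  simp only [dyadicPoint, ite_pow, one_pow, ne_eq, OfNat.ofNat_ne_zero, not_false_eq_true,
    zero_pow, Finset.sum_boole]
  rw [Nat.cast_le_one, Finset.card_le_one]
  intro k hk k' hk'
  simp only [Finset.mem_filter, Finset.mem_univ, true_and] at hk hk'
  exact Fin.ext (by omega)

theorem sum_sq_dyadicCoeff_sub_le (L a b : ℕ) :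
    ∑ s, (dyadicCoeff L b s - dyadicCoeff L a s) ^ 2 ≤ 4 * L := by
  have h : ∀ s, (dyadicCoeff L b s - dyadicCoeff L a s) ^ 2 ≤
      2 * dyadicCoeff L b s ^ 2 + 2 * dyadicCoeff L a s ^ 2 := fun s => by
    nlinarith [sq_nonneg (dyadicCoeff L b s + dyadicCoeff L a s)]
  refine (Finset.sum_le_sum fun s _ => h s).trans ?_
  rw [Finset.sum_add_distrib, ← Finset.mul_sum, ← Finset.mul_sum]
  linarith [sum_sq_dyadicCoeff_le L a, sum_sq_dyadicCoeff_le L b]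

theorem sum_dyadicCoeff_sub_mul_dyadicPoint {L m a b : ℕ} (hm : m < 2 ^ L) (hb : b < 2 ^ L)
    (hab : a ≤ b) :
    ∑ s, (dyadicCoeff L b s - dyadicCoeff L a s) * dyadicPoint L m s =
      if a ≤ m ∧ m < b then 1 else 0 := by
  simp_rw [sub_mul]
  rw [Finset.sum_sub_distrib, sum_dyadicCoeff_mul_dyadicPoint hm hb,
    sum_dyadicCoeff_mul_dyadicPoint hm (hab.trans_lt hb)]
  by_cases h1 : m < b <;> by_cases h2 : m < a <;> by_cases h3 : a ≤ m <;>
    simp [h1, h2, h3] <;> omega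

/-- Rounding with small mean square discrepancy on the boxes of finitely many pairs of rankings. -/
theorem exists_rounding_boxes {ι κ : Type*} [Fintype ι] [DecidableEq ι] [Fintype κ] (L : ℕ)
    (ρ σ : κ → ι → ℕ) (hρ : ∀ c i, ρ c i < 2 ^ L) (hσ : ∀ c i, σ c i < 2 ^ L)
    (wt : Finset ι → ℝ) (hwt : ∀ Y, 0 ≤ wt Y)
    (hY : ∀ Y, wt Y ≠ 0 → ∃ c a b a' b', b < 2 ^ L ∧ b' < 2 ^ L ∧ a ≤ b ∧ a' ≤ b' ∧
      ∀ i, i ∈ Y ↔ (a ≤ ρ c i ∧ ρ c i < b) ∧ (a' ≤ σ c i ∧ σ c i < b'))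
    (x : ι → ℝ) (hx : ∀ i, x i ∈ Set.Icc (0 : ℝ) 1) :
    ∃ χ : ι → ℝ, (∀ i, χ i = 0 ∨ χ i = 1) ∧
      ∑ Y, wt Y * (∑ i ∈ Y, (χ i - x i)) ^ 2 ≤
        16 * Fintype.card κ * (L : ℝ) ^ 4 * ∑ Y, wt Y := by
  classical
  let S := Fin L × Fin (2 ^ L)
  let v : ι → EuclideanSpace ℝ (κ × S × S) := fun i => WithLp.toLp 2 fun r =>
    dyadicPoint L (ρ r.1 i) r.2.1 * dyadicPoint L (σ r.1 i) r.2.2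
  have hv : ∀ i, ‖v i‖ ^ 2 ≤ Fintype.card κ * (L : ℝ) ^ 2 := by
    intro i
    rw [EuclideanSpace.norm_sq_eq, Fintype.sum_prod_type]
    refine (Finset.sum_le_card_nsmul _ _ ((L : ℝ) ^ 2) fun c _ => ?_).trans (by simp)
    rw [Fintype.sum_prod_type]
    simp only [v, Real.norm_eq_abs, sq_abs, mul_pow]
    rw [← Finset.sum_mul_sum, sq]
    exact mul_le_mul (sum_sq_dyadicPoint_le _ _) (sum_sq_dyadicPoint_le _ _)
      (Finset.sum_nonneg fun _ _ => sq_nonneg _) (Nat.cast_nonneg _)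
  have hU : ∀ Y, ∃ U : EuclideanSpace ℝ (κ × S × S), wt Y ≠ 0 →
      ‖U‖ ^ 2 ≤ 16 * (L : ℝ) ^ 2 ∧ ∀ i, inner ℝ U (v i) = if i ∈ Y then 1 else 0 := by
    intro Y
    by_cases h : wt Y = 0
    · exact ⟨0, fun h' => absurd h h'⟩
    obtain ⟨c, a, b, a', b', hb, hb', hab, hab', hi⟩ := hY Y h
    refine ⟨WithLp.toLp 2 fun r => if r.1 = c then
      (dyadicCoeff L b r.2.1 - dyadicCoeff L a r.2.1) *
      (dyadicCoeff L b' r.2.2 - dyadicCoeff L a' r.2.2) else 0, fun _ => ⟨?_, fun i => ?_⟩⟩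
    · rw [EuclideanSpace.norm_sq_eq, Fintype.sum_prod_type, Finset.sum_eq_single c]
      · rw [Fintype.sum_prod_type]
        simp only [if_true, Real.norm_eq_abs, sq_abs, mul_pow]
        rw [← Finset.sum_mul_sum]
        refine (mul_le_mul (sum_sq_dyadicCoeff_sub_le L a b) (sum_sq_dyadicCoeff_sub_le L a' b')
          (Finset.sum_nonneg fun _ _ => sq_nonneg _) (by positivity)).trans (by nlinarith)
      · intro c' _ hc'
        simp [hc']
      · simp
    · rw [PiLp.inner_apply, Fintype.sum_prod_type, Finset.sum_eq_single c]
      · rw [Fintype.sum_prod_type]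
        simp only [if_true, v, RCLike.inner_apply, conj_trivial]
        have : ∀ s s' : S, dyadicPoint L (ρ c i) s * dyadicPoint L (σ c i) s' *
            ((dyadicCoeff L b s - dyadicCoeff L a s) *
            (dyadicCoeff L b' s' - dyadicCoeff L a' s')) =
            ((dyadicCoeff L b s - dyadicCoeff L a s) * dyadicPoint L (ρ c i) s) *
            ((dyadicCoeff L b' s' - dyadicCoeff L a' s') * dyadicPoint L (σ c i) s') :=
          fun s s' => by ring
        simp_rw [this]
        rw [← Finset.sum_mul_sum, sum_dyadicCoeff_sub_mul_dyadicPoint (hρ c i) hb hab,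
          sum_dyadicCoeff_sub_mul_dyadicPoint (hσ c i) hb' hab']
        simp only [hi i, ite_and, mul_ite, mul_one, mul_zero]
        split_ifs <;> rfl
      · intro c' _ hc'
        simp [hc']
      · simp
  choose U hU using hU
  obtain ⟨χ, hχ, hle⟩ := exists_rounding wt hwt U v (by positivity) hv x hx
  refine ⟨χ, hχ, ?_⟩
  calc ∑ Y, wt Y * (∑ i ∈ Y, (χ i - x i)) ^ 2
      = ∑ Y, wt Y * (∑ i, (χ i - x i) * inner ℝ (U Y) (v i)) ^ 2 := by
        refine Finset.sum_congr rfl fun Y _ => ?_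
        by_cases h : wt Y = 0
        · simp [h]
        · simp [(hU Y h).2]
    _ ≤ Fintype.card κ * (L : ℝ) ^ 2 * ∑ Y, wt Y * ‖U Y‖ ^ 2 := hle
    _ ≤ Fintype.card κ * (L : ℝ) ^ 2 * ∑ Y, wt Y * (16 * (L : ℝ) ^ 2) := by
        refine mul_le_mul_of_nonneg_left (Finset.sum_le_sum fun Y _ => ?_) (by positivity)
        by_cases h : wt Y = 0
        · simp [h]
        · exact mul_le_mul_of_nonneg_left (hU Y h).1 (hwt Y)
    _ = 16 * Fintype.card κ * (L : ℝ) ^ 4 * ∑ Y, wt Y := by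
        rw [← Finset.sum_mul]; ring

end Dyadic

section Directions

/-- The integer vectors of size at most `N` with negative component in the direction `φ`. -/
def signKey (N : ℕ) (φ : ℝ) : Finset (ℤ × ℤ) :=
  (Finset.Icc (-(N : ℤ)) N ×ˢ Finset.Icc (-(N : ℤ)) N).filter
    fun v => (v.1 : ℝ) * Real.cos φ + (v.2 : ℝ) * Real.sin φ < 0

theorem mem_signKey {N : ℕ} {φ : ℝ} {v : ℤ × ℤ} :
    v ∈ signKey N φ ↔ (|v.1| ≤ N ∧ |v.2| ≤ N) ∧
      (v.1 : ℝ) * Real.cos φ + (v.2 : ℝ) * Real.sin φ < 0 := by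
  simp [signKey, abs_le]

theorem abs_component_sub_le {N : ℕ} {a b : ℝ} (ha : |a| ≤ N) (hb : |b| ≤ N) (φ x : ℝ) :
    |(a * Real.cos φ + b * Real.sin φ) - (a * Real.cos x + b * Real.sin x)| ≤
      2 * N * |φ - x| := by
  have h : (a * Real.cos φ + b * Real.sin φ) - (a * Real.cos x + b * Real.sin x) =
    a * (Real.cos φ - Real.cos x) + b * (Real.sin φ - Real.sin x) := by ring
  rw [h]
  refine (abs_add_le _ _).trans ?_
  rw [abs_mul, abs_mul]
  have h1 := mul_le_mul ha (Real.abs_cos_sub_cos_le φ x) (abs_nonneg _) (Nat.cast_nonneg N)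
  have h2 := mul_le_mul hb (Real.abs_sin_sub_sin_le φ x) (abs_nonneg _) (Nat.cast_nonneg N)
  linarith

/-- Two integer vectors that are both almost orthogonal to the direction `x` are parallel. -/
theorem cross_eq_zero_of_small {N : ℕ} {v v₀ : ℤ × ℤ} {x ε : ℝ}
    (hv : |v.1| ≤ N ∧ |v.2| ≤ N) (hv₀ : |v₀.1| ≤ N ∧ |v₀.2| ≤ N)
    (h : |(v.1 : ℝ) * Real.cos x + (v.2 : ℝ) * Real.sin x| ≤ ε)
    (h₀ : |(v₀.1 : ℝ) * Real.cos x + (v₀.2 : ℝ) * Real.sin x| ≤ ε)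
    (hε : 4 * N * ε < 1) : v.1 * v₀.2 - v.2 * v₀.1 = 0 := by
  have hperp : ∀ u : ℤ × ℤ, |u.1| ≤ N ∧ |u.2| ≤ N →
      |(u.2 : ℝ) * Real.cos x - (u.1 : ℝ) * Real.sin x| ≤ 2 * N := by
    intro u hu
    have h1 : |(u.1 : ℝ)| ≤ N := by exact_mod_cast hu.1
    have h2 : |(u.2 : ℝ)| ≤ N := by exact_mod_cast hu.2
    refine (abs_sub _ _).trans ?_
    rw [abs_mul, abs_mul]
    have h3 := mul_le_mul h2 (Real.abs_cos_le_one x) (abs_nonneg _) (Nat.cast_nonneg N)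
    have h4 := mul_le_mul h1 (Real.abs_sin_le_one x) (abs_nonneg _) (Nat.cast_nonneg N)
    linarith
  have hid : ((v.1 * v₀.2 - v.2 * v₀.1 : ℤ) : ℝ) =
      ((v.1 : ℝ) * Real.cos x + (v.2 : ℝ) * Real.sin x) *
        ((v₀.2 : ℝ) * Real.cos x - (v₀.1 : ℝ) * Real.sin x) -
      ((v₀.1 : ℝ) * Real.cos x + (v₀.2 : ℝ) * Real.sin x) *
        ((v.2 : ℝ) * Real.cos x - (v.1 : ℝ) * Real.sin x) := by
    push_cast
    linear_combination (-((v.1 : ℝ) * v₀.2 - v.2 * v₀.1)) * Real.sin_sq_add_cos_sq x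
  have hε0 : 0 ≤ ε := (abs_nonneg _).trans h
  have hlt : |((v.1 * v₀.2 - v.2 * v₀.1 : ℤ) : ℝ)| < 1 := by
    rw [hid]
    refine (abs_sub _ _).trans_lt ?_
    rw [abs_mul, abs_mul]
    have h1 := mul_le_mul h (hperp v₀ hv₀) (abs_nonneg _) hε0
    have h2 := mul_le_mul h₀ (hperp v hv) (abs_nonneg _) hε0
    linarith
  rw [← Int.cast_abs] at hlt
  exact Int.abs_lt_one_iff.1 (by exact_mod_cast hlt)

/-- Directions in a short interval have at most three different sign patterns. -/
theorem exists_signKey_of_interval {N : ℕ} (x : ℝ) {δ : ℝ} (hδ : 8 * (N : ℝ) ^ 2 * δ < 1) :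
    ∃ F : SignType → Finset (ℤ × ℤ), ∀ φ ∈ Set.Icc x (x + δ), ∃ s, signKey N φ = F s := by
  classical
  have hclose : ∀ φ ∈ Set.Icc x (x + δ), ∀ v : ℤ × ℤ, (|v.1| ≤ N ∧ |v.2| ≤ N) →
      |((v.1 : ℝ) * Real.cos φ + v.2 * Real.sin φ) - (v.1 * Real.cos x + v.2 * Real.sin x)| ≤
      2 * N * δ := by
    intro φ hφ v hv
    refine (abs_component_sub_le (N := N) (by exact_mod_cast hv.1) (by exact_mod_cast hv.2)
      φ x).trans ?_
    have : |φ - x| ≤ δ := by rw [abs_le]; constructor <;> linarith [hφ.1, hφ.2]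
    gcongr
  have hsign : ∀ φ ∈ Set.Icc x (x + δ), ∀ v : ℤ × ℤ, (|v.1| ≤ N ∧ |v.2| ≤ N) →
      2 * N * δ < |(v.1 : ℝ) * Real.cos x + v.2 * Real.sin x| →
      ((v.1 : ℝ) * Real.cos φ + v.2 * Real.sin φ < 0 ↔
        (v.1 : ℝ) * Real.cos x + v.2 * Real.sin x < 0) := by
    intro φ hφ v hv hlt
    have := abs_le.1 (hclose φ hφ v hv)
    rcases lt_abs.1 hlt with h | h
    · constructor <;> intro h' <;> linarith
    · constructor <;> intro h' <;> linarith
  by_cases hex : ∃ v₀ : ℤ × ℤ, v₀ ≠ 0 ∧ (|v₀.1| ≤ N ∧ |v₀.2| ≤ N) ∧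
      |(v₀.1 : ℝ) * Real.cos x + v₀.2 * Real.sin x| ≤ 2 * N * δ
  · obtain ⟨v₀, hne, hv₀, hsmall⟩ := hex
    refine ⟨fun s => (Finset.Icc (-(N : ℤ)) N ×ˢ Finset.Icc (-(N : ℤ)) N).filter fun v =>
      if v.1 * v₀.2 - v.2 * v₀.1 = 0 then ((v.1 * v₀.1 + v.2 * v₀.2 : ℤ) : ℝ) * (s : ℝ) < 0
      else (v.1 : ℝ) * Real.cos x + v.2 * Real.sin x < 0, fun φ hφ =>
      ⟨SignType.sign ((v₀.1 : ℝ) * Real.cos φ + v₀.2 * Real.sin φ), ?_⟩⟩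
    refine Finset.filter_congr fun v hv => ?_
    have hv' : |v.1| ≤ N ∧ |v.2| ≤ N := by simpa [abs_le] using hv
    split_ifs with hc
    · have hsq : (0 : ℝ) < (v₀.1 : ℝ) ^ 2 + (v₀.2 : ℝ) ^ 2 := by
        by_contra hle
        refine hne (Prod.ext ?_ ?_)
        · have : (v₀.1 : ℝ) = 0 := by nlinarith [sq_nonneg (v₀.1 : ℝ), sq_nonneg (v₀.2 : ℝ)]
          exact_mod_cast this
        · have : (v₀.2 : ℝ) = 0 := by nlinarith [sq_nonneg (v₀.1 : ℝ), sq_nonneg (v₀.2 : ℝ)]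
          exact_mod_cast this
      have hc' : (v.1 : ℝ) * v₀.2 - v.2 * v₀.1 = 0 := by exact_mod_cast hc
      set H := (v₀.1 : ℝ) * Real.cos φ + v₀.2 * Real.sin φ with hH
      have hid : ((v.1 : ℝ) * Real.cos φ + v.2 * Real.sin φ) *
          ((v₀.1 : ℝ) ^ 2 + (v₀.2 : ℝ) ^ 2) = ((v.1 * v₀.1 + v.2 * v₀.2 : ℤ) : ℝ) * H := by
        rw [hH]; push_cast
        linear_combination ((v₀.2 : ℝ) * Real.cos φ - v₀.1 * Real.sin φ) * hc'
      have h1 : (v.1 : ℝ) * Real.cos φ + v.2 * Real.sin φ < 0 ↔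
          ((v.1 * v₀.1 + v.2 * v₀.2 : ℤ) : ℝ) * H < 0 := by
        rw [← hid, mul_neg_iff]
        constructor
        · intro h; exact Or.inr ⟨h, hsq⟩
        · rintro (h | h)
          · linarith [h.2]
          · exact h.1
      rw [h1]
      generalize ((v.1 * v₀.1 + v.2 * v₀.2 : ℤ) : ℝ) = D
      rcases lt_trichotomy H 0 with h | h | h
      · simp [sign_neg h, mul_neg_iff, h, h.not_gt]
      · simp [h]
      · simp [sign_pos h, mul_neg_iff, h, h.not_gt]
    · refine hsign φ hφ v hv' ?_
      by_contra hle
      refine hc (cross_eq_zero_of_small hv' hv₀ (not_lt.1 hle) hsmall ?_)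
      nlinarith
  · push Not at hex
    refine ⟨fun _ => signKey N x, fun φ hφ => ⟨0, Finset.filter_congr fun v hv => ?_⟩⟩
    have hv' : |v.1| ≤ N ∧ |v.2| ≤ N := by simpa [abs_le] using hv
    by_cases h0 : v = 0
    · simp [h0]
    · exact hsign φ hφ v hv' (hex v h0 hv')

theorem one_le_plog (N : ℕ) : 1 ≤ plog N := le_max_left _ _

/-- The number of sign patterns of a lacunary set of directions is polylogarithmic. -/
theorem exists_signKeys {M : ℕ} {Ω : Set ℝ} (hcov : LacunaryCovering Ω M) :
    ∃ C : ℝ, 0 < C ∧ ∀ N : ℕ, 2 ≤ N → ∃ 𝒞 : Finset (Finset (ℤ × ℤ)),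
      (𝒞.card : ℝ) ≤ C * plog N ^ M ∧ ∀ φ, (φ ∈ Ω ∨ φ = 0) → signKey N φ ∈ 𝒞 := by
  classical
  obtain ⟨K, hK⟩ := hcov
  refine ⟨3 * |K| * 6 ^ M + 1, by positivity, fun N hN => ?_⟩
  have hN' : (2 : ℝ) ≤ N := by exact_mod_cast hN
  have hNpos : (0 : ℝ) < N := by linarith
  obtain ⟨s, hs, hΩ⟩ := hK (1 / (16 * (N : ℝ) ^ 2)) (by positivity) (by
    rw [div_lt_div_iff₀ (by positivity) (by norm_num)]; nlinarith)
  have hδ : 8 * (N : ℝ) ^ 2 * (1 / (16 * (N : ℝ) ^ 2)) < 1 := by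
    have : 8 * (N : ℝ) ^ 2 * (1 / (16 * (N : ℝ) ^ 2)) = 1 / 2 := by field_simp; norm_num
    rw [this]; norm_num
  choose F hF using fun x => exists_signKey_of_interval (N := N) x hδ
  refine ⟨insert (signKey N 0) (s.biUnion fun x => Finset.univ.image (F x)), ?_, ?_⟩
  · have hcard : (insert (signKey N 0) (s.biUnion fun x => Finset.univ.image (F x))).card ≤
        s.card * 3 + 1 := by
      refine (Finset.card_insert_le _ _).trans (Nat.add_le_add_right ?_ 1)
      exact Finset.card_biUnion_le_card_mul _ _ _ fun x _ => Finset.card_image_le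
    have hlog : Real.logb 2 (1 / (1 / (16 * (N : ℝ) ^ 2))) ≤ 6 * plog N := by
      rw [one_div_one_div, Real.logb_mul (by norm_num) (by positivity), Real.logb_pow]
      have h16 : Real.logb 2 16 = 4 := by
        rw [show (16 : ℝ) = 2 ^ (4 : ℕ) by norm_num, Real.logb_pow, Real.logb_self_eq_one] <;>
          norm_num
      have h1 := one_le_plog N
      have h2 : Real.logb 2 N ≤ plog N := le_max_right _ _
      rw [h16]; push_cast; linarith
    have hlog0 : 0 ≤ Real.logb 2 (1 / (1 / (16 * (N : ℝ) ^ 2))) := by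
      rw [one_div_one_div]
      exact Real.logb_nonneg (by norm_num) (by nlinarith)
    have hs' : (s.card : ℝ) ≤ |K| * (6 * plog N) ^ M := by
      refine hs.trans (mul_le_mul (le_abs_self K) (pow_le_pow_left₀ hlog0 hlog M)
        (pow_nonneg hlog0 _) (abs_nonneg K))
    have h1 : 1 ≤ plog N ^ M := one_le_pow₀ (one_le_plog N)
    calc _ ≤ ((s.card * 3 + 1 : ℕ) : ℝ) := by exact_mod_cast hcard
      _ = s.card * 3 + 1 := by push_cast; ring
      _ ≤ |K| * (6 * plog N) ^ M * 3 + plog N ^ M := by linarith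
      _ = _ := by rw [mul_pow]; ring
  · rintro φ (hφ | rfl)
    · obtain ⟨x, hx⟩ := Set.mem_iUnion.1 (hΩ hφ)
      obtain ⟨hxs, hx⟩ := Set.mem_iUnion.1 hx
      obtain ⟨t, ht⟩ := hF x φ hx
      exact Finset.mem_insert_of_mem (Finset.mem_biUnion.2 ⟨x, hxs, by simp [ht]⟩)
    · exact Finset.mem_insert_self _ _

end Directions

section Geometry

theorem mem_rect {φ w h : ℝ} {p y : ℝ × ℝ} : y ∈ rect φ p w h ↔
    (y.1 - p.1) * Real.cos φ + (y.2 - p.2) * Real.sin φ ∈ Set.Icc 0 w ∧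
    (y.2 - p.2) * Real.cos φ - (y.1 - p.1) * Real.sin φ ∈ Set.Icc 0 h := by
  have hsc := Real.sin_sq_add_cos_sq φ
  constructor
  · rintro ⟨x, ⟨hx1, hx2⟩, rfl⟩
    have h1 : (p + rot φ x).1 - p.1 = x.1 * Real.cos φ - x.2 * Real.sin φ := by simp [rot]
    have h2 : (p + rot φ x).2 - p.2 = x.1 * Real.sin φ + x.2 * Real.cos φ := by simp [rot]
    dsimp only
    rw [h1, h2]
    constructor
    · convert hx1 using 1
      linear_combination x.1 * hsc
    · convert hx2 using 1
      linear_combination x.2 * hsc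
  · rintro ⟨h1, h2⟩
    refine ⟨(_, _), ⟨h1, h2⟩, Prod.ext ?_ ?_⟩
    · simp only [rot, Prod.fst_add]
      linear_combination (y.1 - p.1) * hsc
    · simp only [rot, Prod.snd_add]
      linear_combination (y.2 - p.2) * hsc

theorem volume_rect (φ : ℝ) (p : ℝ × ℝ) {w h : ℝ} (hw : 0 ≤ w) :
    volume (rect φ p w h) = ENNReal.ofReal (w * h) := by
  let B : Matrix (Fin 2) (Fin 2) ℝ := !![Real.cos φ, -Real.sin φ; Real.sin φ, Real.cos φ]
  let f : ℝ × ℝ →ₗ[ℝ] ℝ × ℝ := Matrix.toLin (Module.Basis.finTwoProd ℝ) (Module.Basis.finTwoProd ℝ) B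
  have hf : ∀ x, f x = rot φ x := by
    intro x
    simp only [f, B, Matrix.toLin_finTwoProd_apply, rot]
    ext <;> simp only <;> ring
  have hdet : LinearMap.det f = 1 := by
    simp only [f, LinearMap.det_toLin, B, Matrix.det_fin_two_of]
    linear_combination Real.sin_sq_add_cos_sq φ
  have himg : rect φ p w h = (fun x => p + x) '' (f '' (Set.Icc 0 w ×ˢ Set.Icc 0 h)) := by
    simp only [rect, Set.image_image, hf]
  rw [himg, Set.image_add_left, measure_preimage_add, Measure.addHaar_image_linearMap, hdet]
  rw [Measure.volume_eq_prod, Measure.prod_prod, Real.volume_Icc, Real.volume_Icc]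
  simp [ENNReal.ofReal_mul hw]

theorem volume_rect_toReal (φ : ℝ) (p : ℝ × ℝ) {w h : ℝ} (hw : 0 ≤ w) (hh : 0 ≤ h) :
    (volume (rect φ p w h)).toReal = w * h := by
  rw [volume_rect φ p hw, ENNReal.toReal_ofReal (mul_nonneg hw hh)]

/-- The centres of the cells of the `N × N` grid in the unit square. -/
def gridPoint (N : ℕ) (i : Fin N × Fin N) : ℝ × ℝ :=
  (((i.1 : ℕ) + 1 / 2) / N, ((i.2 : ℕ) + 1 / 2) / N)

theorem gridPoint_mem_unitSq (N : ℕ) (i : Fin N × Fin N) : gridPoint N i ∈ unitSq := by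
  have h : ∀ k : Fin N, ((k : ℕ) + 1 / 2 : ℝ) / N ∈ Set.Icc (0 : ℝ) 1 := fun k => by
    have hk : ((k : ℕ) + 1 : ℝ) ≤ N := by exact_mod_cast k.2
    exact ⟨by positivity, div_le_one_of_le₀ (by linarith) (by positivity)⟩
  exact ⟨h i.1, h i.2⟩

theorem gridPoint_injective {N : ℕ} (hN : 0 < N) : Function.Injective (gridPoint N) := by
  intro i j hij
  have hN' : (N : ℝ) ≠ 0 := by positivity
  simp only [gridPoint, Prod.mk.injEq] at hij
  obtain ⟨h1, h2⟩ := hij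
  rw [div_left_inj' hN', add_left_inj] at h1 h2
  exact Prod.ext (Fin.ext (by exact_mod_cast h1)) (Fin.ext (by exact_mod_cast h2))

open Classical in
/-- The grid points in a set, as a set of indices. -/
def gridTrace (N : ℕ) (R : Set (ℝ × ℝ)) : Finset (Fin N × Fin N) :=
  Finset.univ.filter fun i => gridPoint N i ∈ R

theorem mem_gridTrace {N : ℕ} {R : Set (ℝ × ℝ)} {i : Fin N × Fin N} :
    i ∈ gridTrace N R ↔ gridPoint N i ∈ R := by simp [gridTrace]

/-- The half-open cell of the grid with index `i`. -/
def gridCell (N : ℕ) (i : Fin N × Fin N) : Set (ℝ × ℝ) :=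
  Set.Ico ((i.1 : ℕ) / N : ℝ) (((i.1 : ℕ) + 1) / N) ×ˢ
    Set.Ico ((i.2 : ℕ) / N : ℝ) (((i.2 : ℕ) + 1) / N)

theorem volume_gridCell (N : ℕ) (i : Fin N × Fin N) :
    volume (gridCell N i) = ENNReal.ofReal (1 / (N : ℝ) ^ 2) := by
  rw [gridCell, Measure.volume_eq_prod, Measure.prod_prod, Real.volume_Ico, Real.volume_Ico,
    ← ENNReal.ofReal_mul (by rw [← sub_div]; simp)]
  congr 1
  ring

theorem mem_gridCell_iff {N : ℕ} (hN : 0 < N) {i : Fin N × Fin N} {y : ℝ × ℝ} :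
    y ∈ gridCell N i ↔ ⌊y.1 * N⌋ = (i.1 : ℕ) ∧ ⌊y.2 * N⌋ = (i.2 : ℕ) := by
  have hN' : (0 : ℝ) < N := by exact_mod_cast hN
  simp [gridCell, Int.floor_eq_iff, div_le_iff₀ hN', lt_div_iff₀ hN']

theorem gridCell_disjoint {N : ℕ} (hN : 0 < N) {i j : Fin N × Fin N} (hij : i ≠ j) :
    Disjoint (gridCell N i) (gridCell N j) := by
  rw [Set.disjoint_left]
  intro y hi hj
  rw [mem_gridCell_iff hN] at hi hj
  refine hij (Prod.ext (Fin.ext ?_) (Fin.ext ?_))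
  · have := hi.1.symm.trans hj.1; exact_mod_cast this
  · have := hi.2.symm.trans hj.2; exact_mod_cast this

theorem abs_sub_gridPoint_le {N : ℕ} {i : Fin N × Fin N} {y : ℝ × ℝ} (hy : y ∈ gridCell N i) :
    |y.1 - (gridPoint N i).1| ≤ 1 / (2 * N) ∧ |y.2 - (gridPoint N i).2| ≤ 1 / (2 * N) := by
  obtain ⟨⟨h1, h2⟩, h3, h4⟩ := hy
  have e1 : ∀ k : ℝ, (k + 1 / 2) / N = k / N + 1 / (2 * N) := fun k => by ring
  have e2 : ∀ k : ℝ, (k + 1) / N = k / N + 1 / (2 * N) + 1 / (2 * N) := fun k => by ring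
  rw [e2] at h2 h4
  simp only [gridPoint, e1, abs_le]
  refine ⟨⟨?_, ?_⟩, ?_, ?_⟩ <;> linarith

theorem abs_component_le {φ a b ε : ℝ} (ha : |a| ≤ ε) (hb : |b| ≤ ε) :
    |a * Real.cos φ + b * Real.sin φ| ≤ 2 * ε ∧ |b * Real.cos φ - a * Real.sin φ| ≤ 2 * ε := by
  have hε := (abs_nonneg a).trans ha
  have h : ∀ c d : ℝ, |c| ≤ ε → |d| ≤ 1 → |c * d| ≤ ε := fun c d hc hd => by
    rw [abs_mul]; nlinarith [abs_nonneg c, abs_nonneg d]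
  have hc := Real.abs_cos_le_one φ
  have hs := Real.abs_sin_le_one φ
  constructor
  · exact (abs_add_le _ _).trans (by linarith [h a _ ha hc, h b _ hb hs])
  · exact (abs_sub _ _).trans (by linarith [h b _ hb hc, h a _ ha hs])

/-- The grid has discrepancy at most `8 N` with respect to rectangles in the unit square. -/
theorem abs_card_gridTrace_sub_le {N : ℕ} (hN : 0 < N) {φ w h : ℝ} {p : ℝ × ℝ}
    (hw : w ∈ Set.Ioc (0 : ℝ) 1) (hh : h ∈ Set.Ioc (0 : ℝ) 1) (hR : rect φ p w h ⊆ unitSq) :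
    |((gridTrace N (rect φ p w h)).card : ℝ) / N - N * (w * h)| ≤ 8 := by
  have hN' : (0 : ℝ) < N := by exact_mod_cast hN
  have hN1 : (1 : ℝ) ≤ N := by exact_mod_cast hN
  have hsc := Real.sin_sq_add_cos_sq φ
  set T := gridTrace N (rect φ p w h) with hT
  have hcells : volume (⋃ i ∈ T, gridCell N i) =
      ENNReal.ofReal ((T.card : ℝ) / (N : ℝ) ^ 2) := by
    rw [measure_biUnion_finset (fun i _ j _ hij => gridCell_disjoint hN hij)
      (fun i _ => measurableSet_Ico.prod measurableSet_Ico)]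
    simp_rw [volume_gridCell]
    rw [Finset.sum_const, nsmul_eq_mul, ← ENNReal.ofReal_natCast,
      ← ENNReal.ofReal_mul (by positivity)]
    congr 1
    ring
  have hinv : 2 * (1 / (2 * (N : ℝ))) = 1 / N := by field_simp
  have hupper : (T.card : ℝ) / (N : ℝ) ^ 2 ≤ (w + 2 / N) * (h + 2 / N) := by
    have hsub : (⋃ i ∈ T, gridCell N i) ⊆
        rect φ (p.1 - (Real.cos φ - Real.sin φ) / N, p.2 - (Real.sin φ + Real.cos φ) / N)
          (w + 2 / N) (h + 2 / N) := by
      intro y hy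
      simp only [Set.mem_iUnion] at hy
      obtain ⟨i, hi, hyi⟩ := hy
      obtain ⟨hc1, hc2⟩ := mem_rect.1 (mem_gridTrace.1 hi)
      obtain ⟨h1, h2⟩ := abs_sub_gridPoint_le hyi
      obtain ⟨h3, h4⟩ := abs_component_le (φ := φ) h1 h2
      rw [hinv, abs_le] at h3 h4
      have e1 : (y.1 - (p.1 - (Real.cos φ - Real.sin φ) / N)) * Real.cos φ +
          (y.2 - (p.2 - (Real.sin φ + Real.cos φ) / N)) * Real.sin φ =
          (y.1 - p.1) * Real.cos φ + (y.2 - p.2) * Real.sin φ + 1 / N := by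
        linear_combination (1 / (N : ℝ)) * hsc
      have e2 : (y.2 - (p.2 - (Real.sin φ + Real.cos φ) / N)) * Real.cos φ -
          (y.1 - (p.1 - (Real.cos φ - Real.sin φ) / N)) * Real.sin φ =
          (y.2 - p.2) * Real.cos φ - (y.1 - p.1) * Real.sin φ + 1 / N := by
        linear_combination (1 / (N : ℝ)) * hsc
      have e3 : 2 / (N : ℝ) = 1 / N + 1 / N := by ring
      rw [mem_rect, e1, e2, e3]
      refine ⟨⟨?_, ?_⟩, ?_, ?_⟩ <;> linarith [hc1.1, hc1.2, hc2.1, hc2.2, h3.1, h3.2, h4.1, h4.2]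
    have := measure_mono (μ := volume) hsub
    rw [hcells, volume_rect _ _ (by have := hw.1; positivity)] at this
    exact (ENNReal.ofReal_le_ofReal_iff (by have := hw.1; have := hh.1; positivity)).1 this
  have hlower : w * h - 4 / N ≤ (T.card : ℝ) / (N : ℝ) ^ 2 := by
    have e3 : 2 / (N : ℝ) = 1 / N + 1 / N := by ring
    have e4 : 4 / (N : ℝ) = 2 / N + 2 / N := by ring
    have hT0 : 0 ≤ (T.card : ℝ) / (N : ℝ) ^ 2 := by positivity
    by_cases hw2 : w < 2 / N
    · nlinarith [hw.1, hw.2, hh.1, hh.2]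
    by_cases hh2 : h < 2 / N
    · nlinarith [hw.1, hw.2, hh.1, hh.2]
    have hsub : rect φ (p.1 + (Real.cos φ - Real.sin φ) / N, p.2 + (Real.sin φ + Real.cos φ) / N)
          (w - 2 / N) (h - 2 / N) ⊆ (⋃ i ∈ T, gridCell N i) := by
      intro y hy
      have e1 : (y.1 - (p.1 + (Real.cos φ - Real.sin φ) / N)) * Real.cos φ +
          (y.2 - (p.2 + (Real.sin φ + Real.cos φ) / N)) * Real.sin φ =
          (y.1 - p.1) * Real.cos φ + (y.2 - p.2) * Real.sin φ - 1 / N := by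
        linear_combination (-(1 / (N : ℝ))) * hsc
      have e2 : (y.2 - (p.2 + (Real.sin φ + Real.cos φ) / N)) * Real.cos φ -
          (y.1 - (p.1 + (Real.cos φ - Real.sin φ) / N)) * Real.sin φ =
          (y.2 - p.2) * Real.cos φ - (y.1 - p.1) * Real.sin φ - 1 / N := by
        linear_combination (-(1 / (N : ℝ))) * hsc
      rw [mem_rect, e1, e2, e3] at hy
      obtain ⟨hc1, hc2⟩ := hy
      have hnear : ∀ y' : ℝ × ℝ, |y.1 - y'.1| ≤ 1 / (2 * N) → |y.2 - y'.2| ≤ 1 / (2 * N) →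
          y' ∈ rect φ p w h := by
        intro y' h1 h2
        obtain ⟨h3, h4⟩ := abs_component_le (φ := φ) h1 h2
        rw [hinv, abs_le] at h3 h4
        rw [mem_rect]
        refine ⟨⟨?_, ?_⟩, ?_, ?_⟩ <;>
          linarith [hc1.1, hc1.2, hc2.1, hc2.2, h3.1, h3.2, h4.1, h4.2]
      have hε : (0 : ℝ) < 1 / (2 * N) := by positivity
      have hy0 := hR (hnear y (by simp) (by simp))
      have hy1 := hR (hnear (y.1 + 1 / (2 * N), y.2) (by simp) (by simp))
      have hy2 := hR (hnear (y.1, y.2 + 1 / (2 * N)) (by simp) (by simp))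
      have hfl : ∀ a : ℝ, 0 ≤ a → a < 1 → ∃ k : Fin N, ⌊a * N⌋ = (k : ℕ) := by
        intro a ha ha1
        refine ⟨⟨⌊a * N⌋₊, (Nat.floor_lt (by positivity)).2 (by nlinarith)⟩, ?_⟩
        exact (Int.natCast_floor_eq_floor (by positivity)).symm
      obtain ⟨k, hk⟩ := hfl y.1 hy0.1.1 (by linarith [hy1.1.2])
      obtain ⟨l, hl⟩ := hfl y.2 hy0.2.1 (by linarith [hy2.2.2])
      have hcell : y ∈ gridCell N (k, l) := (mem_gridCell_iff hN).2 ⟨hk, hl⟩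
      obtain ⟨h1, h2⟩ := abs_sub_gridPoint_le hcell
      exact Set.mem_biUnion (mem_gridTrace.2 (hnear _ h1 h2)) hcell
    have := measure_mono (μ := volume) hsub
    rw [hcells, volume_rect _ _ (by linarith), ENNReal.ofReal_le_ofReal_iff hT0] at this
    nlinarith [hw.1, hw.2, hh.1, hh.2, show 0 ≤ 2 / (N : ℝ) by positivity]
  have e5 : (T.card : ℝ) / N = N * ((T.card : ℝ) / (N : ℝ) ^ 2) := by field_simp
  rw [e5, ← mul_sub, abs_mul, abs_of_pos hN']
  have hb : |(T.card : ℝ) / (N : ℝ) ^ 2 - w * h| ≤ 8 / N := by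
    have e6 : 2 / (N : ℝ) * (2 / N) ≤ 4 / N := by
      rw [div_mul_div_comm, div_le_div_iff₀ (by positivity) hN']; nlinarith
    have e8 : 8 / (N : ℝ) = 2 * (2 / N) + 4 / N := by ring
    have e9 : 0 ≤ 2 / (N : ℝ) := by positivity
    rw [abs_le]
    constructor
    · linarith
    · nlinarith [hw.1, hw.2, hh.1, hh.2]
  calc _ ≤ (N : ℝ) * (8 / N) := by gcongr
    _ = 8 := by field_simp

end Geometry

section Ranks

/-- The condition `α ≤ f i ≤ β` in terms of the ranks of the values of `f`. -/
theorem exists_rank_interval {ι : Type*} [Fintype ι] (f : ι → ℝ) {α β : ℝ} (hαβ : α ≤ β) :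
    ∃ a b : ℕ, a ≤ b ∧ b ≤ Fintype.card ι ∧ ∀ i, (α ≤ f i ∧ f i ≤ β) ↔
      a ≤ (Finset.univ.filter fun j => f j < f i).card ∧
        (Finset.univ.filter fun j => f j < f i).card < b := by
  refine ⟨(Finset.univ.filter fun j => f j < α).card, (Finset.univ.filter fun j => f j ≤ β).card,
    Finset.card_le_card (Finset.monotone_filter_right _ fun j _ hj => hj.le.trans hαβ),
    Finset.card_le_univ _, fun i => and_congr ?_ ?_⟩
  · constructor
    · exact fun h => Finset.card_le_card
        (Finset.monotone_filter_right _ fun j _ hj => lt_of_lt_of_le hj h)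
    · intro h
      by_contra hlt
      rw [not_le] at hlt
      refine absurd h (not_le.2 (Finset.card_lt_card ?_))
      rw [Finset.ssubset_iff_of_subset
        (Finset.monotone_filter_right _ fun j _ hj => lt_trans hj hlt)]
      exact ⟨i, by simpa using hlt, by simp⟩
  · constructor
    · intro h
      refine Finset.card_lt_card ?_
      rw [Finset.ssubset_iff_of_subset
        (Finset.monotone_filter_right _ fun j _ hj => hj.le.trans h)]
      exact ⟨i, by simpa using h, by simp⟩
    · intro h
      by_contra hlt
      rw [not_le] at hlt
      exact absurd h (not_lt.2 (Finset.card_le_card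
        (Finset.monotone_filter_right _ fun j _ hj => lt_of_le_of_lt hj hlt)))

/-- The rank of a grid point in a direction with sign pattern `k`. -/
def keyRank (N : ℕ) (k : Finset (ℤ × ℤ)) (i : Fin N × Fin N) : ℕ :=
  (Finset.univ.filter fun j : Fin N × Fin N =>
    (((j.1 : ℕ) : ℤ) - (i.1 : ℕ), ((j.2 : ℕ) : ℤ) - (i.2 : ℕ)) ∈ k).card

/-- The rank of a grid point in the direction orthogonal to one with sign pattern `k`. -/
def keyRankPerp (N : ℕ) (k : Finset (ℤ × ℤ)) (i : Fin N × Fin N) : ℕ :=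
  (Finset.univ.filter fun j : Fin N × Fin N =>
    (((j.2 : ℕ) : ℤ) - (i.2 : ℕ), ((i.1 : ℕ) : ℤ) - (j.1 : ℕ)) ∈ k).card

theorem abs_fin_sub_le {N : ℕ} (a b : Fin N) : |((a : ℕ) : ℤ) - (b : ℕ)| ≤ N := by
  rw [abs_le]; omega

theorem keyRank_signKey {N : ℕ} (hN : 0 < N) (φ : ℝ) (i : Fin N × Fin N) :
    keyRank N (signKey N φ) i = (Finset.univ.filter fun j =>
      (gridPoint N j).1 * Real.cos φ + (gridPoint N j).2 * Real.sin φ <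
      (gridPoint N i).1 * Real.cos φ + (gridPoint N i).2 * Real.sin φ).card := by
  have hN' : (0 : ℝ) < N := by exact_mod_cast hN
  unfold keyRank
  congr 1
  refine Finset.filter_congr fun j _ => ?_
  rw [mem_signKey, and_iff_right ⟨abs_fin_sub_le _ _, abs_fin_sub_le _ _⟩]
  push_cast
  have : (gridPoint N j).1 * Real.cos φ + (gridPoint N j).2 * Real.sin φ -
      ((gridPoint N i).1 * Real.cos φ + (gridPoint N i).2 * Real.sin φ) =
      ((((j.1 : ℕ) : ℝ) - (i.1 : ℕ)) * Real.cos φ + (((j.2 : ℕ) : ℝ) - (i.2 : ℕ)) * Real.sin φ)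
        / N := by
    simp only [gridPoint]; ring
  rw [← sub_neg (a := (gridPoint N j).1 * Real.cos φ + (gridPoint N j).2 * Real.sin φ), this,
    div_neg_iff]
  simp [hN', hN'.not_gt]

theorem keyRankPerp_signKey {N : ℕ} (hN : 0 < N) (φ : ℝ) (i : Fin N × Fin N) :
    keyRankPerp N (signKey N φ) i = (Finset.univ.filter fun j =>
      (gridPoint N j).2 * Real.cos φ - (gridPoint N j).1 * Real.sin φ <
      (gridPoint N i).2 * Real.cos φ - (gridPoint N i).1 * Real.sin φ).card := by
  have hN' : (0 : ℝ) < N := by exact_mod_cast hN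
  unfold keyRankPerp
  congr 1
  refine Finset.filter_congr fun j _ => ?_
  rw [mem_signKey, and_iff_right ⟨abs_fin_sub_le _ _, abs_fin_sub_le _ _⟩]
  push_cast
  have : (gridPoint N j).2 * Real.cos φ - (gridPoint N j).1 * Real.sin φ -
      ((gridPoint N i).2 * Real.cos φ - (gridPoint N i).1 * Real.sin φ) =
      ((((j.2 : ℕ) : ℝ) - (i.2 : ℕ)) * Real.cos φ + (((i.1 : ℕ) : ℝ) - (j.1 : ℕ)) * Real.sin φ)
        / N := by
    simp only [gridPoint]; ring
  rw [← sub_neg (a := (gridPoint N j).2 * Real.cos φ - (gridPoint N j).1 * Real.sin φ), this,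
    div_neg_iff]
  simp [hN', hN'.not_gt]

/-- The trace of a rectangle on the grid is a box in terms of the two rankings of its direction. -/
theorem exists_box_gridTrace {N : ℕ} (hN : 0 < N) (φ : ℝ) (p : ℝ × ℝ) {w h : ℝ} (hw : 0 ≤ w)
    (hh : 0 ≤ h) : ∃ a b a' b', b ≤ N * N ∧ b' ≤ N * N ∧ a ≤ b ∧ a' ≤ b' ∧
      ∀ i, i ∈ gridTrace N (rect φ p w h) ↔
        (a ≤ keyRank N (signKey N φ) i ∧ keyRank N (signKey N φ) i < b) ∧
        (a' ≤ keyRankPerp N (signKey N φ) i ∧ keyRankPerp N (signKey N φ) i < b') := by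
  obtain ⟨a, b, hab, hb, hi⟩ := exists_rank_interval (fun i : Fin N × Fin N =>
    (gridPoint N i).1 * Real.cos φ + (gridPoint N i).2 * Real.sin φ)
    (le_add_of_nonneg_right hw : p.1 * Real.cos φ + p.2 * Real.sin φ ≤ _ + w)
  obtain ⟨a', b', hab', hb', hi'⟩ := exists_rank_interval (fun i : Fin N × Fin N =>
    (gridPoint N i).2 * Real.cos φ - (gridPoint N i).1 * Real.sin φ)
    (le_add_of_nonneg_right hh : p.2 * Real.cos φ - p.1 * Real.sin φ ≤ _ + h)
  refine ⟨a, b, a', b', by simpa using hb, by simpa using hb', hab, hab', fun i => ?_⟩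
  rw [mem_gridTrace, mem_rect, keyRank_signKey hN, keyRankPerp_signKey hN, ← hi i, ← hi' i]
  refine and_congr (and_congr ?_ ?_) (and_congr ?_ ?_) <;>
    constructor <;> intro h <;> linarith

end Ranks

section Assembly

theorem integrable_and_integral_of_finite_range {α β : Type*} [MeasurableSpace α] [Fintype β]
    (μ : Measure α) [IsProbabilityMeasure μ] (g : α → β)
    (hg : ∀ b, MeasurableSet (g ⁻¹' {b})) (H : β → ℝ) :
    Integrable (fun a => H (g a)) μ ∧ ∫ a, H (g a) ∂μ = ∑ b, μ.real (g ⁻¹' {b}) * H b := by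
  let _ : MeasurableSpace β := ⊤
  have : MeasurableSingletonClass β := ⟨fun _ => trivial⟩
  have hgm : Measurable g := measurable_to_countable' hg
  have := Measure.isProbabilityMeasure_map (μ := μ) hgm.aemeasurable
  have hintegr : Integrable H (μ.map g) := Integrable.of_finite
  refine ⟨hintegr.comp_measurable hgm, ?_⟩
  rw [← integral_map hgm.aemeasurable hintegr.aestronglyMeasurable, integral_fintype hintegr]
  refine Finset.sum_congr rfl fun b _ => ?_
  rw [map_measureReal_apply hgm (measurableSet_singleton b), smul_eq_mul]

theorem measurableSet_gridTrace_eq {Ω : Set ℝ} (N : ℕ) (Y : Finset (Fin N × Fin N)) :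
    MeasurableSet ((fun t : paramSet Ω =>
      gridTrace N (rect t.1.1 t.1.2.1 t.1.2.2.1 t.1.2.2.2)) ⁻¹' {Y}) := by
  have : ((fun t : paramSet Ω => gridTrace N (rect t.1.1 t.1.2.1 t.1.2.2.1 t.1.2.2.2)) ⁻¹' {Y}) =
      ⋂ i, {t : paramSet Ω | gridPoint N i ∈ rect t.1.1 t.1.2.1 t.1.2.2.1 t.1.2.2.2 ↔ i ∈ Y} := by
    ext t
    simp [Finset.ext_iff, mem_gridTrace]
  rw [this]
  refine MeasurableSet.iInter fun i => MeasurableSet.iff ?_ (MeasurableSet.const _)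
  simp only [mem_rect, Set.mem_Icc]
  have hle {f g : paramSet Ω → ℝ} (hf : Continuous f) (hg : Continuous g) :
      MeasurableSet {t | f t ≤ g t} := measurableSet_le hf.measurable hg.measurable
  refine ((hle ?_ ?_).inter (hle ?_ ?_)).inter ((hle ?_ ?_).inter (hle ?_ ?_)) <;> fun_prop

theorem abs_card_inter_sub_le {ι : Type*} [DecidableEq ι] {A B : Finset ι} (h : A ⊆ B)
    (Y : Finset ι) :
    |((B ∩ Y).card : ℝ) - (A ∩ Y).card| ≤ (B.card : ℝ) - A.card := by
  have h1 : (A ∩ Y).card ≤ (B ∩ Y).card := Finset.card_le_card (Finset.inter_subset_inter_right h)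
  have h2 : (B ∩ Y).card + A.card ≤ (A ∩ Y).card + B.card := by
    have e1 := Finset.card_sdiff_add_card_eq_card h
    have e2 : (B ∩ Y) ⊆ (A ∩ Y) ∪ (B \ A) := by
      intro i hi
      by_cases hA : i ∈ A <;> simp_all
    have e3 := (Finset.card_le_card e2).trans (Finset.card_union_le _ _)
    omega
  have h1' : ((A ∩ Y).card : ℝ) ≤ (B ∩ Y).card := by exact_mod_cast h1
  have h2' : ((B ∩ Y).card : ℝ) + A.card ≤ (A ∩ Y).card + B.card := by exact_mod_cast h2
  rw [abs_of_nonneg (by linarith)]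
  linarith

/-- A finite set can be corrected to one with exactly `n` elements, changing every count by at most
the defect of its cardinality. -/
theorem exists_card_eq_abs_card_inter_sub_le {ι : Type*} [Fintype ι] [DecidableEq ι]
    (A : Finset ι) {n : ℕ} (hn : n ≤ Fintype.card ι) :
    ∃ B : Finset ι, B.card = n ∧
      ∀ Y : Finset ι, |((B ∩ Y).card : ℝ) - (A ∩ Y).card| ≤ |(A.card : ℝ) - n| := by
  rcases le_total A.card n with h | h
  · obtain ⟨B, hAB, -, hB⟩ := Finset.exists_subsuperset_card_eq (Finset.subset_univ A) h hn
    refine ⟨B, hB, fun Y => ?_⟩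
    rw [abs_sub_comm (A.card : ℝ), ← hB]
    exact (abs_card_inter_sub_le hAB Y).trans (le_abs_self _)
  · obtain ⟨B, hBA, hB⟩ := Finset.exists_subset_card_eq h
    refine ⟨B, hB, fun Y => ?_⟩
    rw [abs_sub_comm, ← hB]
    exact (abs_card_inter_sub_le hBA Y).trans (le_abs_self _)

/-- The mean square discrepancy bound in terms of the number of sign patterns. -/
theorem exists_points_of_signKeys {Ω : Set ℝ} {N : ℕ} (hN : 2 ≤ N) {𝒞 : Finset (Finset (ℤ × ℤ))}
    (h𝒞 : ∀ φ, (φ ∈ Ω ∨ φ = 0) → signKey N φ ∈ 𝒞) {L : ℕ} (hL : N * N < 2 ^ L)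
    (μ : Measure (paramSet Ω)) [IsProbabilityMeasure μ] :
    ∃ P : Finset (ℝ × ℝ), P.card = N ∧ (P : Set (ℝ × ℝ)) ⊆ unitSq ∧
      ∫ t, (|(((P : Set (ℝ × ℝ)) ∩ rect t.1.1 t.1.2.1 t.1.2.2.1 t.1.2.2.2).ncard : ℝ) -
        (N : ℝ) * (volume (rect t.1.1 t.1.2.1 t.1.2.2.1 t.1.2.2.2)).toReal|) ^ 2 ∂μ ≤
        192 * 𝒞.card * (L : ℝ) ^ 4 + 192 := by
  classical
  have hN0 : 0 < N := by omega
  have hNR : (0 : ℝ) < N := by exact_mod_cast hN0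
  let tr : paramSet Ω → Finset (Fin N × Fin N) :=
    fun t => gridTrace N (rect t.1.1 t.1.2.1 t.1.2.2.1 t.1.2.2.2)
  have hintegr := integrable_and_integral_of_finite_range μ tr (measurableSet_gridTrace_eq N)
  let lam : Finset (Fin N × Fin N) → ℝ := fun Y => μ.real (tr ⁻¹' {Y})
  have hlam : ∀ Y, 0 ≤ lam Y := fun Y => measureReal_nonneg
  have hlam1 : ∑ Y, lam Y = 1 := by
    have := (hintegr fun _ => 1).2
    simpa using this.symm
  let wt : Finset (Fin N × Fin N) → ℝ := fun Y => lam Y + if Y = Finset.univ then 1 else 0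
  have hrank : ∀ (k : {k // k ∈ 𝒞}) i, keyRank N k.1 i < 2 ^ L := fun k i =>
    (Finset.card_le_univ _).trans_lt (by simpa using hL)
  have hrank' : ∀ (k : {k // k ∈ 𝒞}) i, keyRankPerp N k.1 i < 2 ^ L := fun k i =>
    (Finset.card_le_univ _).trans_lt (by simpa using hL)
  have hbox : ∀ (φ : ℝ) (p : ℝ × ℝ) (w h : ℝ), (φ ∈ Ω ∨ φ = 0) → 0 ≤ w → 0 ≤ h →
      ∃ (c : {k // k ∈ 𝒞}) (a b a' b' : ℕ), b < 2 ^ L ∧ b' < 2 ^ L ∧ a ≤ b ∧ a' ≤ b' ∧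
      ∀ i, i ∈ gridTrace N (rect φ p w h) ↔ (a ≤ keyRank N c.1 i ∧ keyRank N c.1 i < b) ∧
        (a' ≤ keyRankPerp N c.1 i ∧ keyRankPerp N c.1 i < b') := by
    intro φ p w h hφ hw hh
    obtain ⟨a, b, a', b', hb, hb', hrest⟩ := exists_box_gridTrace hN0 φ p hw hh
    exact ⟨⟨_, h𝒞 φ hφ⟩, a, b, a', b', hb.trans_lt hL, hb'.trans_lt hL, hrest⟩
  obtain ⟨χ, hχ, hle⟩ := exists_rounding_boxes L (fun (k : {k // k ∈ 𝒞}) => keyRank N k.1)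
    (fun k => keyRankPerp N k.1) hrank hrank' wt
    (fun Y => add_nonneg (hlam Y) (by split_ifs <;> norm_num)) (fun Y hY => by
      by_cases hu : Y = Finset.univ
      · have : Y = gridTrace N (rect 0 0 1 1) := by
          ext i
          have := gridPoint_mem_unitSq N i
          simp only [unitSq, Set.mem_prod] at this
          simp [hu, mem_gridTrace, mem_rect, this.1.1, this.1.2, this.2.1, this.2.2]
        rw [this]
        exact hbox 0 0 1 1 (Or.inr rfl) zero_le_one zero_le_one
      · have hne : μ.real (tr ⁻¹' {Y}) ≠ 0 := by simpa [wt, hu, lam] using hY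
        have : (tr ⁻¹' {Y}).Nonempty := by
          by_contra h0
          rw [Set.not_nonempty_iff_eq_empty] at h0
          simp [h0] at hne
        obtain ⟨t, ht⟩ := this
        obtain ⟨-, hφ, -, hw, hh, -⟩ := t.2
        have ht' : gridTrace N (rect t.1.1 t.1.2.1 t.1.2.2.1 t.1.2.2.2) = Y := ht
        rw [← ht']
        exact hbox _ _ _ _ hφ hw.1.le hh.1.le)
    (fun _ => 1 / (N : ℝ)) (fun _ => ⟨by positivity, div_le_one_of_le₀
      (by exact_mod_cast hN0) hNR.le⟩)
  set B : ℝ := 16 * Fintype.card {k // k ∈ 𝒞} * (L : ℝ) ^ 4 * ∑ Y, wt Y with hBdef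
  have hB : B = 32 * 𝒞.card * (L : ℝ) ^ 4 := by
    have : ∑ Y, wt Y = 2 := by
      simp only [wt, Finset.sum_add_distrib, hlam1]
      simp
      norm_num
    rw [hBdef, this, Fintype.card_coe]; ring
  let disc : Finset (Fin N × Fin N) → ℝ := fun Y => ∑ i ∈ Y, (χ i - 1 / (N : ℝ))
  have hsum : ∑ Y, lam Y * disc Y ^ 2 + disc Finset.univ ^ 2 ≤ B := by
    refine le_trans (le_of_eq ?_) hle
    simp only [wt, add_mul, Finset.sum_add_distrib, ite_mul, one_mul, zero_mul]
    simp [disc]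
  have hsum0 : 0 ≤ ∑ Y, lam Y * disc Y ^ 2 :=
    Finset.sum_nonneg fun Y _ => mul_nonneg (hlam Y) (sq_nonneg _)
  let P₀ : Finset (Fin N × Fin N) := Finset.univ.filter fun i => χ i = 1
  have hdisc : ∀ Y, disc Y = ((P₀ ∩ Y).card : ℝ) - Y.card / N := by
    intro Y
    have h1 : ∑ i ∈ Y, χ i = ((P₀ ∩ Y).card : ℝ) := by
      rw [Finset.inter_comm, ← Finset.filter_mem_eq_inter, Finset.card_filter]
      push_cast
      refine Finset.sum_congr rfl fun i _ => ?_
      rcases hχ i with h | h <;> simp [P₀, h]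
    simp only [disc, Finset.sum_sub_distrib, h1, Finset.sum_const, nsmul_eq_mul]
    ring
  have hP₀ : ((P₀.card : ℝ) - N) ^ 2 ≤ B := by
    have : disc Finset.univ = (P₀.card : ℝ) - N := by
      rw [hdisc, Finset.inter_univ]
      simp
    rw [← this]
    linarith
  obtain ⟨P', hP'card, hP'⟩ := exists_card_eq_abs_card_inter_sub_le P₀ (n := N)
    (by simpa using Nat.le_mul_self N)
  refine ⟨P'.image (gridPoint N), ?_, ?_, ?_⟩
  · rw [Finset.card_image_of_injective _ (gridPoint_injective hN0), hP'card]
  · intro y hy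
    obtain ⟨i, -, rfl⟩ := Finset.mem_image.1 (Finset.mem_coe.1 hy)
    exact gridPoint_mem_unitSq N i
  have hpoint : ∀ t : paramSet Ω,
      (|((((P'.image (gridPoint N) : Finset (ℝ × ℝ)) : Set (ℝ × ℝ)) ∩
        rect t.1.1 t.1.2.1 t.1.2.2.1 t.1.2.2.2).ncard : ℝ) -
        (N : ℝ) * (volume (rect t.1.1 t.1.2.1 t.1.2.2.1 t.1.2.2.2)).toReal|) ^ 2 ≤
        3 * B + 192 + 3 * disc (tr t) ^ 2 := by
    intro t
    obtain ⟨-, -, -, hw, hh, hR⟩ := t.2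
    rw [volume_rect_toReal _ _ hw.1.le hh.1.le, sq_abs]
    have hset : (((P'.image (gridPoint N) : Finset (ℝ × ℝ)) : Set (ℝ × ℝ)) ∩
        rect t.1.1 t.1.2.1 t.1.2.2.1 t.1.2.2.2) = gridPoint N '' ((P' ∩ tr t : Finset _) : Set _) := by
      ext y
      simp only [Finset.coe_image, Set.mem_inter_iff, Set.mem_image, Finset.mem_coe,
        Finset.mem_inter, tr, mem_gridTrace]
      constructor
      · rintro ⟨⟨i, hi, rfl⟩, hy⟩
        exact ⟨i, ⟨hi, hy⟩, rfl⟩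
      · rintro ⟨i, ⟨hi, hy⟩, rfl⟩
        exact ⟨⟨i, hi, rfl⟩, hy⟩
    rw [hset, Set.ncard_image_of_injective _ (gridPoint_injective hN0), Set.ncard_coe_finset]
    have h1 : (((P' ∩ tr t).card : ℝ) - (P₀ ∩ tr t).card) ^ 2 ≤ B :=
      (sq_le_sq.2 (hP' (tr t))).trans hP₀
    have h2 := sq_le_sq.2 ((abs_card_gridTrace_sub_le hN0 hw hh hR).trans
      (le_abs_self (8 : ℝ)))
    have h3 := hdisc (tr t)
    set u := ((P' ∩ tr t).card : ℝ) - (P₀ ∩ tr t).card with hu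
    set v := ((tr t).card : ℝ) / N - N * (t.1.2.2.1 * t.1.2.2.2) with hv
    have h2' : v ^ 2 ≤ 64 := h2.trans (by norm_num)
    have : ((P' ∩ tr t).card : ℝ) - N * (t.1.2.2.1 * t.1.2.2.2) = u + disc (tr t) + v := by
      rw [h3, hu, hv]; ring
    rw [this]
    nlinarith [sq_nonneg (u - v), sq_nonneg (u - disc (tr t)), sq_nonneg (v - disc (tr t))]
  obtain ⟨hi, hieq⟩ := hintegr fun Y => 3 * B + 192 + 3 * disc Y ^ 2
  refine (integral_mono_of_nonneg (Filter.Eventually.of_forall fun t => sq_nonneg _) hi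
    (Filter.Eventually.of_forall hpoint)).trans ?_
  rw [hieq]
  have : ∑ Y, μ.real (tr ⁻¹' {Y}) * (3 * B + 192 + 3 * disc Y ^ 2) =
      (3 * B + 192) * ∑ Y, lam Y + 3 * ∑ Y, lam Y * disc Y ^ 2 := by
    rw [Finset.mul_sum, Finset.mul_sum, ← Finset.sum_add_distrib]
    exact Finset.sum_congr rfl fun Y _ => by simp only [lam]; ring
  rw [this, hlam1]
  nlinarith [sq_nonneg (disc Finset.univ)]

end Assembly

/-- If `Ω ⊆ [0, π/2]` is lacunary of order `M`, then for every `N ≥ 2` and every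
probability measure `μ` on the parameter space of rectangles pointing in the directions
of `Ω ∪ {0}` and contained in `[0,1]²`, there is an `N`-point set `P ⊆ [0,1]²` whose
`L²(μ)`-discrepancy is at most `C (log N)^{2M + 1/2}`. -/
theorem L2_discrepancy_lacunary_order_M
    (M : ℕ) (hM : 1 ≤ M) (Ω : Set ℝ) (hΩ : Ω ⊆ Set.Icc 0 (Real.pi / 2))
    (hcov : LacunaryCovering Ω M) :
    ∃ C : ℝ, 0 < C ∧ ∀ N : ℕ, 2 ≤ N →
      ∀ μ : Measure (paramSet Ω), IsProbabilityMeasure μ →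
        ∃ P : Finset (ℝ × ℝ), P.card = N ∧ (P : Set (ℝ × ℝ)) ⊆ unitSq ∧
          Real.sqrt (∫ t, (|(((P : Set (ℝ × ℝ)) ∩
                rect t.1.1 t.1.2.1 t.1.2.2.1 t.1.2.2.2).ncard : ℝ) -
              (N : ℝ) * (volume (rect t.1.1 t.1.2.1 t.1.2.2.1 t.1.2.2.2)).toReal|) ^ 2 ∂μ)
            ≤ C * (plog N) ^ (2 * (M : ℝ) + 1 / 2) := by
  obtain ⟨C, hC, hkeys⟩ := exists_signKeys hcov
  refine ⟨√(15552 * C + 192), by positivity, fun N hN μ hμ => ?_⟩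
  obtain ⟨𝒞, hcard, h𝒞⟩ := hkeys N hN
  obtain ⟨P, hPcard, hPsq, hP⟩ := exists_points_of_signKeys hN h𝒞
    (Nat.lt_pow_succ_log_self one_lt_two (N * N)) μ
  refine ⟨P, hPcard, hPsq, ?_⟩
  have hq := one_le_plog N
  have hq0 : 0 ≤ plog N := zero_le_one.trans hq
  have hL : (((Nat.log 2 (N * N)).succ : ℕ) : ℝ) ≤ 3 * plog N := by
    have h1 := Real.natLog_le_logb (N * N) 2
    have h2 : Real.logb 2 N ≤ plog N := le_max_right _ _
    have hN0 : (N : ℝ) ≠ 0 := by positivity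
    push_cast at h1 ⊢
    rw [Real.logb_mul hN0 hN0] at h1
    linarith
  have hpow : plog N ^ (M + 4) ≤ plog N ^ (4 * M + 1) := pow_le_pow_right₀ hq (by omega)
  have hone : 1 ≤ plog N ^ (4 * M + 1) := one_le_pow₀ hq
  have hbound : 192 * (𝒞.card : ℝ) * (((Nat.log 2 (N * N)).succ : ℕ) : ℝ) ^ 4 + 192 ≤
      (15552 * C + 192) * plog N ^ (4 * M + 1) := by
    calc 192 * (𝒞.card : ℝ) * (((Nat.log 2 (N * N)).succ : ℕ) : ℝ) ^ 4 + 192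
        ≤ 192 * (C * plog N ^ M) * (3 * plog N) ^ 4 + 192 := by gcongr
      _ = 15552 * C * plog N ^ (M + 4) + 192 := by ring
      _ ≤ 15552 * C * plog N ^ (4 * M + 1) + 192 * plog N ^ (4 * M + 1) := by
          gcongr
          linarith
      _ = _ := by ring
  have hsq : (plog N ^ (2 * (M : ℝ) + 1 / 2)) ^ 2 = plog N ^ (4 * M + 1) := by
    rw [← Real.rpow_natCast, ← Real.rpow_natCast, ← Real.rpow_mul hq0]
    congr 1
    push_cast
    ring
  refine Real.sqrt_le_iff.2 ⟨by positivity, hP.trans (hbound.trans_eq ?_)⟩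
  rw [mul_pow, Real.sq_sqrt (by positivity), hsq]

end
end

section
/- Let 0 ≤ d < 1 and let Ω ⊆ (0, π/2) have upper Minkowski dimension at most d. Then for each ε > 0 there exist α ∈ ℝ and a constant c > 0 such that for all γ ∈ Ω, all integers p, and all positive integers q, one has |tan(α − γ) − p/q| > c · q^{−2/(1−d)² − ε}. -/
noncomputable section

/-- `Ω` has upper Minkowski dimension at most `d`: for every `s > d` there is a constant
`C_s` such that for every `0 < δ < 1` the set `Ω` can be covered by at most `C_s δ^{-s}`
intervals of length `δ`. -/
def MinkowskiBound (Ω : Set ℝ) (d : ℝ) : Prop :=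
  ∀ s : ℝ, d < s → ∃ Cs : ℝ, ∀ δ : ℝ, 0 < δ → δ < 1 →
    ∃ F : Finset ℝ, (F.card : ℝ) ≤ Cs * δ ^ (-s) ∧
      Ω ⊆ ⋃ x ∈ F, Set.Icc x (x + δ)

open MeasureTheory Filter Topology

theorem Real.abs_arctan_sub_arctan_le (x y : ℝ) :
    |Real.arctan x - Real.arctan y| ≤ |x - y| := by
  have hbound : ∀ z ∈ (Set.univ : Set ℝ), ‖1 / (1 + z ^ 2)‖ ≤ 1 := fun z _ => by
    rw [Real.norm_of_nonneg (by positivity)]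
    exact div_le_one_of_le₀ (by nlinarith [sq_nonneg z]) (by positivity)
  simpa using convex_univ.norm_image_sub_le_of_norm_hasDerivWithin_le
    (fun z _ => (Real.hasDerivAt_arctan z).hasDerivWithinAt) hbound
    (Set.mem_univ y) (Set.mem_univ x)

theorem volume_biUnion_Icc_le {ι : Type*} (I : Finset ι) (a : ι → ℝ) (ℓ : ℝ) :
    volume (⋃ i ∈ I, Set.Icc (a i) (a i + ℓ)) ≤ ENNReal.ofReal (I.card * ℓ) := by
  refine (measure_biUnion_finset_le _ _).trans (le_of_eq ?_)
  simp [Real.volume_Icc, ENNReal.ofReal_mul]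

/-- The set of `α` within `δ` of `γ + arctan (p / q)` for some `γ ∈ Ω` and `|p| ≤ N q` has small
measure, if `Ω` is covered by few intervals of length `δ`. -/
theorem exists_cover_of_near_translates {Ω : Set ℝ} {δ M : ℝ} (hδ : 0 ≤ δ) (N q : ℕ) (hq : 0 < q)
    (hN : 0 < N) {F : Finset ℝ} (hF : (F.card : ℝ) ≤ M) (hcover : Ω ⊆ ⋃ x ∈ F, Set.Icc x (x + δ)) :
    ∃ B : Set ℝ, volume B ≤ ENNReal.ofReal (9 * N * q * (M * δ)) ∧
      ∀ γ ∈ Ω, ∀ p : ℤ, |p| ≤ N * q → ∀ α : ℝ,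
        |α - γ - Real.arctan ((p : ℝ) / (q : ℝ))| ≤ δ → α ∈ B := by
  let P : Finset ℤ := Finset.Icc (-(N * q : ℤ)) (N * q)
  let a : ℤ × ℝ → ℝ := fun z => z.2 + Real.arctan ((z.1 : ℝ) / (q : ℝ)) - δ
  refine ⟨⋃ z ∈ P ×ˢ F, Set.Icc (a z) (a z + 3 * δ), ?_, ?_⟩
  · refine (volume_biUnion_Icc_le _ _ _).trans (ENNReal.ofReal_le_ofReal ?_)
    have hP : (P.card : ℝ) ≤ 3 * N * q := by
      have h1 : (P.card : ℤ) = 2 * (N * q) + 1 := by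
        simp only [P, Int.card_Icc]
        rw [Int.toNat_of_nonneg (by linarith [(by positivity : (0 : ℤ) ≤ N * q)])]
        ring
      have h2 : (P.card : ℝ) = 2 * (N * q) + 1 := by exact_mod_cast h1
      have h3 : (1 : ℝ) ≤ N * q := by exact_mod_cast Nat.mul_pos hN hq
      linarith
    have hPF : (P.card : ℝ) * F.card ≤ 3 * N * q * M :=
      mul_le_mul hP hF (by positivity) (by positivity)
    rw [Finset.card_product, Nat.cast_mul]
    nlinarith
  · intro γ hγ p hp α hα
    obtain ⟨x, hx, hxγ⟩ := Set.mem_iUnion₂.1 (hcover hγ)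
    refine Set.mem_iUnion₂.2 ⟨(p, x), Finset.mem_product.2 ⟨Finset.mem_Icc.2 (abs_le.1 hp), hx⟩, ?_⟩
    rw [abs_le] at hα
    constructor <;> simp only [a] <;> linarith [hxγ.1, hxγ.2, hα.1, hα.2]

/-- If `b (1 - d) > 2`, then a small multiple of `q ^ (-b)` is exceeded by the distance of
`tan (α - γ)` to `p / q`, for some `α` that does not depend on `γ`, `p` and `q`. -/
theorem MinkowskiBound.exists_tan_sub_diophantine {d b : ℝ} (hd1 : d < 1) {Ω : Set ℝ}
    (hΩ : Ω ⊆ Set.Ioo 0 (Real.pi / 2)) (hmink : MinkowskiBound Ω d) (hb : 2 < b * (1 - d)) :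
    ∃ (α : ℝ) (c : ℝ), 0 < c ∧ ∀ γ ∈ Ω, ∀ (p : ℤ) (q : ℕ), 0 < q →
      c * (q : ℝ) ^ (-b) < |Real.tan (α - γ) - (p : ℝ) / (q : ℝ)| := by
  have hb0 : 0 < b := by
    by_contra! h
    nlinarith
  obtain ⟨s, hds, hs⟩ : ∃ s, d < s ∧ s < 1 - 2 / b := by
    apply exists_between
    have : 2 / b < 1 - d := by rwa [div_lt_iff₀ hb0, mul_comm]
    linarith
  have hs1 : s < 1 := hs.trans (by linarith [div_pos two_pos hb0])
  have hbs : 2 < b * (1 - s) := by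
    have : 2 / b < 1 - s := by linarith
    rwa [div_lt_iff₀ hb0, mul_comm] at this
  obtain ⟨C, hC⟩ := hmink s hds
  have hpi := Real.pi_pos
  obtain ⟨N, hNtan⟩ := exists_nat_gt (Real.tan (3 * Real.pi / 8) + 1)
  have hN : 0 < N := by
    have := Real.tan_pos_of_pos_of_lt_pi_div_two (x := 3 * Real.pi / 8) (by linarith) (by linarith)
    have : (0 : ℝ) < N := by linarith
    exact_mod_cast this
  set f : ℕ → ℝ := fun n => ((n + 1 : ℕ) : ℝ) ^ (1 - b * (1 - s))
  have hfsum : Summable f :=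
    (summable_nat_add_iff 1).2 (Real.summable_nat_rpow.2 (by linarith))
  have hlim : Tendsto (fun c : ℝ => ∑' n, 9 * N * C * c ^ (1 - s) * f n) (𝓝[>] 0) (𝓝 0) := by
    simp_rw [tsum_mul_left]
    have h : Tendsto (fun c : ℝ => c ^ (1 - s)) (𝓝[>] 0) (𝓝 0) := by
      have := (Real.continuousAt_rpow_const 0 (1 - s) (Or.inr (by linarith))).tendsto
      rw [Real.zero_rpow (by linarith)] at this
      exact this.mono_left nhdsWithin_le_nhds
    simpa using (h.const_mul (9 * N * C)).mul_const (∑' n, f n)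
  obtain ⟨c, hcsum, hc0, hc1⟩ : ∃ c : ℝ, (∑' n, 9 * N * C * c ^ (1 - s) * f n) < Real.pi / 4 ∧
      0 < c ∧ c < 1 :=
    ((hlim.eventually_lt_const (by linarith)).and
      (Ioo_mem_nhdsGT (zero_lt_one (α := ℝ)))).exists
  have hC0 : 0 ≤ C := by
    obtain ⟨F, hF, -⟩ := hC c hc0 hc1
    by_contra! h
    nlinarith [Real.rpow_pos_of_pos hc0 (-s), (Nat.cast_nonneg F.card : (0 : ℝ) ≤ F.card)]
  have hbad : ∀ n : ℕ, ∃ B : Set ℝ, volume B ≤ ENNReal.ofReal (9 * N * C * c ^ (1 - s) * f n) ∧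
      ∀ γ ∈ Ω, ∀ p : ℤ, |p| ≤ N * (n + 1 : ℕ) → ∀ α : ℝ,
        |α - γ - Real.arctan ((p : ℝ) / ((n + 1 : ℕ) : ℝ))| ≤ c * ((n + 1 : ℕ) : ℝ) ^ (-b) →
          α ∈ B := by
    intro n
    set q : ℕ := n + 1 with hq
    have hq0 : (0 : ℝ) < q := by positivity
    have hq1 : (1 : ℝ) ≤ q := by simp [hq]
    have hδ0 : 0 < c * (q : ℝ) ^ (-b) := by positivity
    have hqb : (q : ℝ) ^ (-b) ≤ 1 := Real.rpow_le_one_of_one_le_of_nonpos hq1 (by linarith)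
    obtain ⟨F, hF, hcover⟩ := hC (c * (q : ℝ) ^ (-b)) hδ0 (by nlinarith)
    obtain ⟨B, hB, hB'⟩ := exists_cover_of_near_translates hδ0.le N q n.succ_pos hN hF hcover
    refine ⟨B, hB.trans_eq ?_, hB'⟩
    have h1 : (c * (q : ℝ) ^ (-b)) ^ (-s) * (c * (q : ℝ) ^ (-b))
        = c ^ (1 - s) * (q : ℝ) ^ (-(b * (1 - s))) := by
      rw [← Real.rpow_add_one hδ0.ne', Real.mul_rpow hc0.le (by positivity), ← Real.rpow_mul hq0.le]
      ring_nf
    have h2 : f n = q * (q : ℝ) ^ (-(b * (1 - s))) := by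
      rw [mul_comm (q : ℝ), ← Real.rpow_add_one hq0.ne', neg_add_eq_sub]
    rw [mul_assoc C, h1, h2]
    ring_nf
  choose B hBvol hB using hbad
  have hvol : volume (⋃ n, B n) < volume (Set.Icc (Real.pi / 8) (3 * Real.pi / 8)) := by
    calc volume (⋃ n, B n) ≤ ∑' n, volume (B n) := measure_iUnion_le _
      _ ≤ ∑' n, ENNReal.ofReal (9 * N * C * c ^ (1 - s) * f n) := ENNReal.tsum_le_tsum hBvol
      _ = ENNReal.ofReal (∑' n, 9 * N * C * c ^ (1 - s) * f n) :=
        (ENNReal.ofReal_tsum_of_nonneg (fun n => by positivity) (hfsum.mul_left _)).symm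
      _ < ENNReal.ofReal (Real.pi / 4) := (ENNReal.ofReal_lt_ofReal_iff (by linarith)).2 hcsum
      _ = volume (Set.Icc (Real.pi / 8) (3 * Real.pi / 8)) := by
        rw [Real.volume_Icc]
        ring_nf
  obtain ⟨α, hα, hαB⟩ : ∃ α ∈ Set.Icc (Real.pi / 8) (3 * Real.pi / 8), α ∉ ⋃ n, B n := by
    by_contra! h
    exact hvol.not_ge (measure_mono h)
  refine ⟨α, c, hc0, fun γ hγ p q hq => ?_⟩
  by_contra! hle
  obtain ⟨n, rfl⟩ : ∃ n, q = n + 1 := ⟨q - 1, by omega⟩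
  have hγ' := hΩ hγ
  have hlo : -(3 * Real.pi / 8) ≤ α - γ := by linarith [hα.1, hγ'.2]
  have hhi : α - γ ≤ 3 * Real.pi / 8 := by linarith [hα.2, hγ'.1]
  have htan : |Real.tan (α - γ)| ≤ Real.tan (3 * Real.pi / 8) := by
    rw [abs_le, ← Real.tan_neg]
    constructor <;> apply Real.strictMonoOn_tan.monotoneOn <;>
      first | assumption | constructor <;> linarith
  have hq1 : (1 : ℝ) ≤ ((n + 1 : ℕ) : ℝ) := by simp
  have hp : |p| ≤ N * (n + 1 : ℕ) := by
    have h1 : |(p : ℝ) / ((n + 1 : ℕ) : ℝ)| ≤ N := by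
      have h2 : ((n + 1 : ℕ) : ℝ) ^ (-b) ≤ 1 :=
        Real.rpow_le_one_of_one_le_of_nonpos hq1 (by linarith)
      have h3 : c * ((n + 1 : ℕ) : ℝ) ^ (-b) ≤ 1 :=
        mul_le_one₀ hc1.le (by positivity) h2
      rw [abs_le] at *
      constructor <;> linarith [htan.1, htan.2, hle.1, hle.2]
    rw [abs_div, Nat.abs_cast, div_le_iff₀ (by linarith)] at h1
    exact_mod_cast h1
  refine hαB (Set.mem_iUnion.2 ⟨n, hB n γ hγ p hp α (le_trans ?_ hle)⟩)
  have := Real.abs_arctan_sub_arctan_le (Real.tan (α - γ)) ((p : ℝ) / ((n + 1 : ℕ) : ℝ))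
  rwa [Real.arctan_tan (by linarith) (by linarith)] at this

/-- If `Ω ⊆ (0, π/2)` has upper Minkowski dimension at most `d < 1`, then for each
`ε > 0` there exist `α ∈ ℝ` and `c > 0` such that for all `γ ∈ Ω`, all integers `p`
and all positive integers `q`, `|tan(α - γ) - p/q| > c q^{-2/(1-d)² - ε}`. -/
theorem minkowski_diophantine
    (d : ℝ) (hd0 : 0 ≤ d) (hd1 : d < 1) (Ω : Set ℝ)
    (hΩ : Ω ⊆ Set.Ioo 0 (Real.pi / 2)) (hmink : MinkowskiBound Ω d)
    (ε : ℝ) (hε : 0 < ε) :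
    ∃ (α : ℝ) (c : ℝ), 0 < c ∧
      ∀ γ ∈ Ω, ∀ (p : ℤ) (q : ℕ), 0 < q →
        |Real.tan (α - γ) - (p : ℝ) / (q : ℝ)| >
          c * (q : ℝ) ^ (-(2 / (1 - d) ^ 2) - ε) := by
  have h1 : 0 < 1 - d := by linarith
  have hb : 2 < (2 / (1 - d) ^ 2 + ε) * (1 - d) := by
    have h2 : 2 / (1 - d) ^ 2 * (1 - d) = 2 / (1 - d) := by field_simp
    have h3 : 2 ≤ 2 / (1 - d) := by
      rw [le_div_iff₀ h1]
      linarith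
    nlinarith [mul_pos hε h1]
  rw [← neg_add']
  exact hmink.exists_tan_sub_diophantine hd1 hΩ hb

end
end
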